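/- For every nonzero F ∈ 𝒜*, one has ‖𝓗(F)‖_{L∞(ℝ)} ≥ ‖F‖_{L¹(ℝ)}, where ‖𝓗(F)‖_{L∞(ℝ)} denotes the essential supremum of |𝓗(F)| over ℝ. Consequently the infimum in the extremal problem (EP2) equals 1 (it is at least 1). -/

import Mathlib

open MeasureTheory Filter

/-- The principal-value Hilbert transform of `F` at `x` exists and equals `L`:
`𝓗(F)(x) = lim_{ε→0⁺} (1/π)·∫_{|t|≥ε} F(x−t)/t dt`. -/
def pvHilbAt (F : ℝ → ℝ) (x L : ℝ) : Prop :=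
  Tendsto (fun ε : ℝ => (1 / Real.pi) * ∫ t in {t : ℝ | ε ≤ |t|}, F (x - t) / t)
    (nhdsWithin 0 (Set.Ioi 0)) (nhds L)

/-- The class `𝒜*`: `F ∈ L¹(ℝ)`, `F ≥ 0` a.e., support contained in `[-1/2,1/2]`. -/
def memAstar (F : ℝ → ℝ) : Prop :=
  Integrable F ∧ (∀ᵐ x ∂(volume : Measure ℝ), 0 ≤ F x) ∧
    ∀ᵐ x ∂(volume : Measure ℝ), x ∉ Set.Icc (-(1/2) : ℝ) (1/2) → F x = 0
open scoped Topology

/-- Dyadic domination of the Poisson kernel. -/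
lemma poisson_dyadic (δ s : ℝ) (hδ : 0 < δ) :
    ∃ k : ℕ, |s| ≤ 2 ^ k * δ ∧ δ / (s ^ 2 + δ ^ 2) ≤ 4 * (1 / 4) ^ k / δ := by
  classical
  have hex : ∃ k : ℕ, |s| ≤ 2 ^ k * δ := by
    obtain ⟨k, hk⟩ := pow_unbounded_of_one_lt (|s| / δ) (one_lt_two)
    exact ⟨k, by rw [div_lt_iff₀ hδ] at hk; exact hk.le⟩
  refine ⟨Nat.find hex, Nat.find_spec hex, ?_⟩
  rcases h : Nat.find hex with _ | m
  · rw [div_le_div_iff₀ (by positivity) hδ]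
    nlinarith [sq_nonneg s, sq_nonneg δ]
  · have hm : ¬ (|s| ≤ 2 ^ m * δ) := Nat.find_min hex (by omega)
    push Not at hm
    have h2 : (2 ^ m * δ) ^ 2 ≤ s ^ 2 := by
      rw [← sq_abs s]
      exact pow_le_pow_left₀ (by positivity) hm.le 2
    have h4 : (4 : ℝ) * (1 / 4) ^ (m + 1) = 1 / 4 ^ m := by
      rw [pow_succ, div_pow, one_pow]; ring
    have h5 : (2 ^ m * δ) ^ 2 = 4 ^ m * δ ^ 2 := by
      rw [mul_pow, ← pow_mul, mul_comm m 2, pow_mul]; norm_num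
    rw [h4, div_le_div_iff₀ (by positivity) hδ, div_mul_eq_mul_div, le_div_iff₀ (by positivity)]
    nlinarith [sq_nonneg δ]

lemma poisson_leb (F : ℝ → ℝ) (hF : Integrable F) :
    ∀ᵐ x ∂(volume : Measure ℝ),
      Tendsto (fun δ : ℝ => ∫ y, |F y - F x| * (δ / ((x - y) ^ 2 + δ ^ 2)))
        (𝓝[>] 0) (𝓝 0) := by
  filter_upwards [IsUnifLocDoublingMeasure.ae_tendsto_average_norm_sub (volume : Measure ℝ)
    hF.locallyIntegrable 1] with x hx
  set avg : ℝ → ℝ := fun ρ => ⨍ y in Metric.closedBall x ρ, ‖F y - F x‖ with havg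
  have hlim : Tendsto avg (𝓝[>] 0) (𝓝 0) := by
    refine hx (fun _ => x) (fun ρ => ρ) tendsto_id ?_
    filter_upwards [self_mem_nhdsWithin] with ρ hρ
    simp only [Metric.mem_closedBall, dist_self, one_mul]
    exact le_of_lt hρ
  have havg_eq : ∀ ρ, 0 < ρ → avg ρ = (2 * ρ)⁻¹ * ∫ y in Metric.closedBall x ρ, |F y - F x| := by
    intro ρ hρ
    simp only [havg, setAverage_eq, smul_eq_mul, Real.norm_eq_abs]
    rw [Real.volume_real_closedBall hρ.le]
  have havg_nn : ∀ ρ, 0 < ρ → 0 ≤ avg ρ := by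
    intro ρ hρ
    rw [havg_eq ρ hρ]
    have : 0 ≤ ∫ y in Metric.closedBall x ρ, |F y - F x| := integral_nonneg fun _ => abs_nonneg _
    positivity
  have hInt : ∀ ρ, IntegrableOn (fun y => |F y - F x|) (Metric.closedBall x ρ) := by
    intro ρ
    refine Integrable.abs (hF.integrableOn.sub ?_)
    exact integrableOn_const measure_closedBall_lt_top.ne
  obtain ⟨C, hC⟩ : ∃ C, ∀ ρ, 0 < ρ → avg ρ ≤ C := by
    have h1 : ∀ᶠ ρ in 𝓝[>] (0 : ℝ), avg ρ < 1 := hlim.eventually (gt_mem_nhds one_pos)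
    obtain ⟨η, hη, h1⟩ := mem_nhdsGT_iff_exists_Ioo_subset.1 h1
    have hη : 0 < η := hη
    refine ⟨1 + ((2 * η)⁻¹ * (∫ y, |F y|) + |F x|), fun ρ hρ => ?_⟩
    have hI : 0 ≤ ∫ y, |F y| := integral_nonneg fun _ => abs_nonneg _
    by_cases h : ρ < η
    · have := h1 ⟨hρ, h⟩
      simp only [Set.mem_ofPred_eq] at this
      have h3 : 0 ≤ (2 * η)⁻¹ * (∫ y, |F y|) + |F x| := by positivity
      linarith
    · push Not at h
      rw [havg_eq ρ hρ]
      have h2 : ∫ y in Metric.closedBall x ρ, |F y - F x| ≤ (∫ y, |F y|) + 2 * ρ * |F x| := by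
        calc _ ≤ ∫ y in Metric.closedBall x ρ, (|F y| + |F x|) := by
              refine integral_mono (hInt ρ) (hF.abs.integrableOn.add
                (integrableOn_const measure_closedBall_lt_top.ne)) fun y => ?_
              exact abs_sub _ _
          _ = (∫ y in Metric.closedBall x ρ, |F y|) + 2 * ρ * |F x| := by
              rw [integral_add hF.abs.integrableOn (integrableOn_const measure_closedBall_lt_top.ne)]
              simp [Real.volume_real_closedBall hρ.le]
          _ ≤ _ := by
              have := setIntegral_le_integral (s := Metric.closedBall x ρ) hF.abs
                (Eventually.of_forall fun _ => abs_nonneg _)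
              linarith
      calc _ ≤ (2 * ρ)⁻¹ * ((∫ y, |F y|) + 2 * ρ * |F x|) := by gcongr
        _ = (2 * ρ)⁻¹ * (∫ y, |F y|) + |F x| := by field_simp
        _ ≤ (2 * η)⁻¹ * (∫ y, |F y|) + |F x| := by gcongr
        _ ≤ _ := by linarith
  have hC0 : 0 ≤ C := (havg_nn 1 one_pos).trans (hC 1 one_pos)
  have hsum : Summable (fun k : ℕ => 8 * (1 / 2 : ℝ) ^ k * C) :=
    (summable_geometric_two.mul_left 8).mul_right C
  have hT : Tendsto (fun δ : ℝ => ∑' k : ℕ, 8 * (1 / 2 : ℝ) ^ k * avg (2 ^ k * δ)) (𝓝[>] 0)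
      (𝓝 (∑' k : ℕ, (0 : ℝ))) := by
    refine tendsto_tsum_of_dominated_convergence hsum ?_ ?_
    · intro k
      have h1 : Tendsto (fun δ : ℝ => 2 ^ k * δ) (𝓝[>] 0) (𝓝[>] 0) := by
        refine tendsto_nhdsWithin_iff.2 ⟨?_, ?_⟩
        · have : Tendsto (fun δ : ℝ => 2 ^ k * δ) (𝓝 0) (𝓝 (2 ^ k * 0)) :=
            (continuous_const.mul continuous_id).tendsto 0
          rw [mul_zero] at this
          exact this.mono_left nhdsWithin_le_nhds
        · filter_upwards [self_mem_nhdsWithin] with δ hδ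
          have : (0 : ℝ) < δ := hδ
          exact Set.mem_Ioi.2 (by positivity)
      simpa using (hlim.comp h1).const_mul (8 * (1 / 2 : ℝ) ^ k)
    · filter_upwards [self_mem_nhdsWithin] with δ hδ k
      have hδ : (0 : ℝ) < δ := hδ
      have h0 := havg_nn (2 ^ k * δ) (by positivity)
      rw [Real.norm_of_nonneg (by positivity)]
      have := hC (2 ^ k * δ) (by positivity)
      gcongr
  rw [tsum_zero] at hT
  refine squeeze_zero' ?_ ?_ hT
  · filter_upwards [self_mem_nhdsWithin] with δ hδ
    have hδ : (0 : ℝ) < δ := hδ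
    exact integral_nonneg fun y => by positivity
  · filter_upwards [self_mem_nhdsWithin] with δ hδ
    have hδ : (0 : ℝ) < δ := hδ
    have hnn : ∀ k : ℕ, 0 ≤ 8 * (1 / 2 : ℝ) ^ k * avg (2 ^ k * δ) := fun k => by
      have h0 := havg_nn (2 ^ k * δ) (by positivity)
      positivity
    have hsm : Summable fun k : ℕ => 8 * (1 / 2 : ℝ) ^ k * avg (2 ^ k * δ) := by
      refine Summable.of_nonneg_of_le hnn (fun k => ?_) hsum
      have := hC (2 ^ k * δ) (by positivity)
      gcongr
    have hmeas : AEStronglyMeasurable (fun y => |F y - F x|) volume :=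
      (continuous_abs.comp_aestronglyMeasurable (hF.aestronglyMeasurable.sub
        aestronglyMeasurable_const))
    have hker : Continuous fun y : ℝ => δ / ((x - y) ^ 2 + δ ^ 2) := by
      refine continuous_const.div (by fun_prop) fun y => by positivity
    have hm2 : AEStronglyMeasurable
        (fun y => |F y - F x| * (δ / ((x - y) ^ 2 + δ ^ 2))) volume :=
      hmeas.mul hker.aestronglyMeasurable
    have hn2 : ∀ y, 0 ≤ |F y - F x| * (δ / ((x - y) ^ 2 + δ ^ 2)) := fun y => by positivity
    rw [integral_eq_lintegral_of_nonneg_ae (Eventually.of_forall hn2) hm2]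
    refine ENNReal.toReal_le_of_le_ofReal (tsum_nonneg hnn) ?_
    rw [ENNReal.ofReal_tsum_of_nonneg hnn hsm]
    calc _ ≤ ∫⁻ y, ∑' k : ℕ, (Metric.closedBall x (2 ^ k * δ)).indicator
              (fun y => ENNReal.ofReal (4 * (1 / 4) ^ k / δ * |F y - F x|)) y := by
            refine lintegral_mono fun y => ?_
            obtain ⟨k, hk1, hk2⟩ := poisson_dyadic δ (x - y) hδ
            refine le_trans ?_ (ENNReal.le_tsum k)
            rw [Set.indicator_of_mem]
            · apply ENNReal.ofReal_le_ofReal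
              rw [mul_comm]
              gcongr
            · rw [Metric.mem_closedBall, dist_comm, Real.dist_eq]; exact hk1
      _ = ∑' k : ℕ, ∫⁻ y, (Metric.closedBall x (2 ^ k * δ)).indicator
              (fun y => ENNReal.ofReal (4 * (1 / 4) ^ k / δ * |F y - F x|)) y := by
            refine lintegral_tsum fun k => ?_
            exact ((hmeas.aemeasurable.const_mul _).ennreal_ofReal).indicator
              measurableSet_closedBall
      _ = _ := by
            congr 1
            ext1 k
            rw [lintegral_indicator measurableSet_closedBall,
              ← ofReal_integral_eq_lintegral_ofReal ((hInt _).const_mul _)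
                (Eventually.of_forall fun y => by positivity), integral_const_mul,
              havg_eq _ (by positivity)]
            congr 1
            have h4 : ((1 : ℝ) / 4) ^ k = (1 / 2) ^ k * (2 ^ k)⁻¹ := by
              rw [← inv_pow, ← mul_pow]; norm_num
            rw [h4]
            field_simp
            ring

/-- The Cauchy transform. -/
noncomputable def cauchyT (F : ℝ → ℝ) (z : ℂ) : ℂ :=
  ((1 / Real.pi : ℝ) : ℂ) * ∫ t : ℝ, (F t : ℂ) / (z - t)

lemma sub_ofReal_ne (z : ℂ) (hz : 0 < z.im) (t : ℝ) : z - t ≠ 0 := by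
  intro h
  have := congrArg Complex.im h
  simp at this
  exact hz.ne' this

lemma im_le_norm_sub (z : ℂ) (t : ℝ) : z.im ≤ ‖z - t‖ := by
  have := Complex.abs_im_le_norm (z - t)
  simp at this
  exact (le_abs_self _).trans this

lemma integrable_cauchy (F : ℝ → ℝ) (hF : Integrable F) (z : ℂ) (hz : 0 < z.im) :
    Integrable (fun t : ℝ => (F t : ℂ) / (z - t)) := by
  have h1 : Integrable (fun t : ℝ => (F t : ℂ)) := hF.ofReal
  have hc : Continuous (fun t : ℝ => (z - t : ℂ)⁻¹) :=
    Continuous.inv₀ (by fun_prop) (sub_ofReal_ne z hz)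
  have := h1.mul_bdd (c := z.im⁻¹) (g := fun t : ℝ => (z - t : ℂ)⁻¹) hc.aestronglyMeasurable
    (Eventually.of_forall fun t => by
      rw [norm_inv]
      exact inv_anti₀ hz (im_le_norm_sub z t))
  simpa [div_eq_mul_inv] using this

lemma ker_re_im (x δ t : ℝ) (hδ : 0 < δ) (a : ℝ) :
    ((a : ℂ) / ((x : ℂ) + δ * Complex.I - t)).re = a * ((x - t) / ((x - t) ^ 2 + δ ^ 2)) ∧
    ((a : ℂ) / ((x : ℂ) + δ * Complex.I - t)).im = -(a * (δ / ((x - t) ^ 2 + δ ^ 2))) := by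
  have h : (x - t) ^ 2 + δ ^ 2 ≠ 0 := by positivity
  have h2 : (x - t) * (x - t) + δ * δ ≠ 0 := by simpa [sq] using h
  constructor
  · simp [Complex.div_re, Complex.normSq_apply]
    field_simp
  · simp [Complex.div_im, Complex.normSq_apply]
    field_simp

lemma cauchyT_re (F : ℝ → ℝ) (hF : Integrable F) (x δ : ℝ) (hδ : 0 < δ) :
    (cauchyT F ((x : ℂ) + δ * Complex.I)).re =
      (1 / Real.pi) * ∫ t, F t * ((x - t) / ((x - t) ^ 2 + δ ^ 2)) := by
  have hI := integrable_cauchy F hF ((x : ℂ) + δ * Complex.I) (by simpa using hδ)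
  have := integral_re hI
  rw [cauchyT, Complex.re_ofReal_mul]
  congr 1
  rw [← RCLike.re_eq_complex_re, ← this]
  exact integral_congr_ae (Eventually.of_forall fun t => (ker_re_im x δ t hδ (F t)).1)

lemma cauchyT_im (F : ℝ → ℝ) (hF : Integrable F) (x δ : ℝ) (hδ : 0 < δ) :
    (cauchyT F ((x : ℂ) + δ * Complex.I)).im =
      -((1 / Real.pi) * ∫ t, F t * (δ / ((x - t) ^ 2 + δ ^ 2))) := by
  have hI := integrable_cauchy F hF ((x : ℂ) + δ * Complex.I) (by simpa using hδ)
  have := integral_im hI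
  rw [cauchyT, Complex.im_ofReal_mul, ← mul_neg, ← integral_neg]
  congr 1
  rw [← RCLike.im_eq_complex_im, ← this]
  exact integral_congr_ae (Eventually.of_forall fun t => (ker_re_im x δ t hδ (F t)).2)

lemma poisson_eq (δ : ℝ) (hδ : 0 < δ) (s : ℝ) :
    δ / (s ^ 2 + δ ^ 2) = δ⁻¹ * (1 + (s / δ) ^ 2)⁻¹ := by
  field_simp
  ring

lemma poisson_integrable0 (δ : ℝ) (hδ : 0 < δ) :
    Integrable (fun s : ℝ => δ / (s ^ 2 + δ ^ 2)) := by
  simp_rw [poisson_eq δ hδ]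
  exact (integrable_inv_one_add_sq.comp_div hδ.ne').const_mul _

lemma poisson_integral0 (δ : ℝ) (hδ : 0 < δ) :
    ∫ s : ℝ, δ / (s ^ 2 + δ ^ 2) = Real.pi := by
  simp_rw [poisson_eq δ hδ]
  rw [integral_const_mul, Measure.integral_comp_div (fun s : ℝ => (1 + s ^ 2)⁻¹) δ,
    integral_univ_inv_one_add_sq, abs_of_pos hδ, smul_eq_mul]
  field_simp

/-- Difference between the conjugate Poisson kernel and the truncated Hilbert kernel. -/
noncomputable def kdiff (δ s : ℝ) : ℝ :=
  s / (s ^ 2 + δ ^ 2) - {t : ℝ | δ ≤ |t|}.indicator (fun t => 1 / t) s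

lemma measurable_trunc (δ : ℝ) :
    Measurable ({t : ℝ | δ ≤ |t|}.indicator (fun t : ℝ => 1 / t)) := by
  refine Measurable.indicator (by fun_prop) ?_
  exact measurableSet_le measurable_const (by fun_prop)

lemma measurable_kdiff (δ : ℝ) : Measurable (kdiff δ) := by
  have := measurable_trunc δ
  unfold kdiff
  fun_prop

lemma kdiff_le (δ s : ℝ) (hδ : 0 < δ) : |kdiff δ s| ≤ δ / (s ^ 2 + δ ^ 2) := by
  unfold kdiff
  by_cases h : δ ≤ |s|
  · rw [Set.indicator_of_mem (by exact h)]
    have hs : 0 < |s| := hδ.trans_le h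
    have hs0 : s ≠ 0 := abs_pos.1 hs
    have : s / (s ^ 2 + δ ^ 2) - 1 / s = -(δ ^ 2 / (s * (s ^ 2 + δ ^ 2))) := by
      field_simp
      ring
    rw [this, abs_neg, abs_div, abs_mul, abs_of_pos (show 0 < s ^ 2 + δ ^ 2 by positivity),
      abs_of_pos (show 0 < δ ^ 2 by positivity), div_le_div_iff₀ (by positivity) (by positivity)]
    have h3 : 0 < s ^ 2 + δ ^ 2 := by positivity
    have : δ * δ * (s ^ 2 + δ ^ 2) ≤ δ * |s| * (s ^ 2 + δ ^ 2) := by gcongr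
    nlinarith
  · rw [Set.indicator_of_notMem (by exact h), sub_zero, abs_div,
      abs_of_pos (show 0 < s ^ 2 + δ ^ 2 by positivity)]
    push Not at h
    gcongr

lemma kdiff_integrable (δ : ℝ) (hδ : 0 < δ) : Integrable (kdiff δ) :=
  (poisson_integrable0 δ hδ).mono' (measurable_kdiff δ).aestronglyMeasurable
    (Eventually.of_forall fun s => kdiff_le δ s hδ)

lemma kdiff_integral (δ : ℝ) : ∫ s, kdiff δ s = 0 := by
  have h : ∀ s, kdiff δ (-s) = - kdiff δ s := by
    intro s
    unfold kdiff
    by_cases h : δ ≤ |s|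
    · rw [Set.indicator_of_mem (by simpa using h), Set.indicator_of_mem (by simpa using h)]
      simp [neg_div, div_neg]
      ring
    · rw [Set.indicator_of_notMem (by simpa using h), Set.indicator_of_notMem (by simpa using h)]
      simp [neg_div]
  have h2 := integral_neg_eq_self (kdiff δ) volume
  simp_rw [h, integral_neg] at h2
  linarith

lemma trunc_eq (F : ℝ → ℝ) (x δ : ℝ) :
    ∫ t in {t : ℝ | δ ≤ |t|}, F (x - t) / t =
      ∫ y, F y * {t : ℝ | δ ≤ |t|}.indicator (fun t => 1 / t) (x - y) := by
  rw [← integral_sub_left_eq_self _ volume x, ← integral_indicator]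
  · refine integral_congr_ae (Eventually.of_forall fun t => ?_)
    simp only [sub_sub_cancel]
    by_cases h : δ ≤ |t|
    · rw [Set.indicator_of_mem (by exact h), Set.indicator_of_mem (by exact h)]
      ring
    · rw [Set.indicator_of_notMem (by exact h), Set.indicator_of_notMem (by exact h)]
      ring
  · exact measurableSet_le measurable_const (by fun_prop)

lemma ct_ae (F : ℝ → ℝ) (hF : Integrable F) :
    ∀ᵐ x : ℝ ∂(volume : Measure ℝ),
      Tendsto (fun δ : ℝ => (cauchyT F ((x : ℂ) + δ * Complex.I)).im) (𝓝[>] 0) (𝓝 (-F x)) ∧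
      Tendsto (fun δ : ℝ => (cauchyT F ((x : ℂ) + δ * Complex.I)).re -
        (1 / Real.pi) * ∫ t in {t : ℝ | δ ≤ |t|}, F (x - t) / t) (𝓝[>] 0) (𝓝 0) := by
  filter_upwards [poisson_leb F hF] with x hx
  have hpi := Real.pi_pos
  have hx' : Tendsto (fun δ : ℝ => (1 / Real.pi) *
      ∫ y, |F y - F x| * (δ / ((x - y) ^ 2 + δ ^ 2))) (𝓝[>] 0) (𝓝 0) := by
    simpa using hx.const_mul (1 / Real.pi)
  -- general kernel estimate
  have key : ∀ δ : ℝ, 0 < δ → ∀ k : ℝ → ℝ, Measurable k → (∀ s, |k s| ≤ δ / (s ^ 2 + δ ^ 2)) →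
      |(∫ y, F y * k (x - y)) - F x * ∫ s, k s| ≤
        ∫ y, |F y - F x| * (δ / ((x - y) ^ 2 + δ ^ 2)) := by
    intro δ hδ k hk hkb
    have hkb' : ∀ s, |k s| ≤ δ⁻¹ := fun s => (hkb s).trans (by
      rw [div_le_iff₀ (by positivity)]
      have : δ⁻¹ * (s ^ 2 + δ ^ 2) = δ⁻¹ * s ^ 2 + δ := by field_simp
      rw [this]
      have : 0 ≤ δ⁻¹ * s ^ 2 := by positivity
      linarith)
    have hkm : Measurable fun y => k (x - y) := hk.comp (by fun_prop)
    have hki : Integrable k := (poisson_integrable0 δ hδ).mono' hk.aestronglyMeasurable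
      (Eventually.of_forall hkb)
    have hki' : Integrable fun y => k (x - y) := hki.comp_sub_left x
    have hFk : Integrable fun y => F y * k (x - y) :=
      hF.mul_bdd hkm.aestronglyMeasurable (Eventually.of_forall fun y => hkb' (x - y))
    rw [← integral_sub_left_eq_self k volume x, ← integral_const_mul,
      ← integral_sub hFk (hki'.const_mul _)]
    refine (abs_integral_le_integral_abs).trans ?_
    refine integral_mono_of_nonneg (Eventually.of_forall fun y => abs_nonneg _) ?_
      (Eventually.of_forall fun y => ?_)
    · have hp : Integrable fun y => δ / ((x - y) ^ 2 + δ ^ 2) :=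
        (poisson_integrable0 δ hδ).comp_sub_left x
      have hFp : Integrable fun y => F y * (δ / ((x - y) ^ 2 + δ ^ 2)) := by
        refine hF.mul_bdd (c := δ⁻¹) hp.aestronglyMeasurable (Eventually.of_forall fun y => ?_)
        rw [Real.norm_of_nonneg (by positivity), div_le_iff₀ (by positivity)]
        have : δ⁻¹ * ((x - y) ^ 2 + δ ^ 2) = δ⁻¹ * (x - y) ^ 2 + δ := by field_simp
        rw [this]
        have : 0 ≤ δ⁻¹ * (x - y) ^ 2 := by positivity
        linarith
      refine (hFp.sub (hp.const_mul (F x))).abs.congr (Eventually.of_forall fun y => ?_)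
      simp only [Pi.sub_apply]
      rw [← sub_mul, abs_mul, abs_of_nonneg (show 0 ≤ δ / ((x - y) ^ 2 + δ ^ 2) by positivity)]
    · simp only
      rw [← sub_mul, abs_mul]
      have := hkb (x - y)
      gcongr
  constructor
  · rw [tendsto_iff_norm_sub_tendsto_zero]
    refine squeeze_zero' (Eventually.of_forall fun _ => norm_nonneg _) ?_ hx'
    filter_upwards [self_mem_nhdsWithin] with δ hδ
    have hδ : 0 < δ := hδ
    have h := key δ hδ (fun s => δ / (s ^ 2 + δ ^ 2)) (by fun_prop)
      (fun s => by rw [abs_of_nonneg (by positivity)])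
    rw [poisson_integral0 δ hδ] at h
    rw [cauchyT_im F hF x δ hδ, Real.norm_eq_abs]
    have e : -(1 / Real.pi * ∫ t, F t * (δ / ((x - t) ^ 2 + δ ^ 2))) - -F x =
        -(1 / Real.pi * ((∫ t, F t * (δ / ((x - t) ^ 2 + δ ^ 2))) - F x * Real.pi)) := by
      generalize (∫ t, F t * (δ / ((x - t) ^ 2 + δ ^ 2))) = J
      field_simp
      ring
    rw [e, abs_neg, abs_mul, abs_of_pos (by positivity : 0 < 1 / Real.pi)]
    gcongr
  · rw [tendsto_zero_iff_norm_tendsto_zero]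
    refine squeeze_zero' (Eventually.of_forall fun _ => norm_nonneg _) ?_ hx'
    filter_upwards [self_mem_nhdsWithin] with δ hδ
    have hδ : 0 < δ := hδ
    have h := key δ hδ (kdiff δ) (measurable_kdiff δ) (fun s => kdiff_le δ s hδ)
    rw [kdiff_integral, mul_zero, sub_zero] at h
    have hI := integrable_cauchy F hF ((x : ℂ) + δ * Complex.I) (by simpa using hδ)
    have hA : Integrable fun y => F y * ((x - y) / ((x - y) ^ 2 + δ ^ 2)) :=
      hI.re.congr (Eventually.of_forall fun t => (ker_re_im x δ t hδ (F t)).1)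
    have hB : Integrable fun y => F y * {t : ℝ | δ ≤ |t|}.indicator (fun t => 1 / t) (x - y) := by
      refine hF.mul_bdd (c := δ⁻¹) ((measurable_trunc δ).comp
        (measurable_const.sub measurable_id)).aestronglyMeasurable
        (Eventually.of_forall fun y => ?_)
      by_cases h : δ ≤ |x - y|
      · rw [Set.indicator_of_mem (by exact h), norm_div, norm_one, one_div]
        exact inv_anti₀ hδ h
      · rw [Set.indicator_of_notMem (by exact h), norm_zero]
        positivity
    rw [cauchyT_re F hF x δ hδ, trunc_eq, ← mul_sub, ← integral_sub hA hB, Real.norm_eq_abs,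
      abs_mul, abs_of_pos (by positivity : 0 < 1 / Real.pi)]
    gcongr
    refine le_trans (le_of_eq ?_) h
    congr 1
    refine integral_congr_ae (Eventually.of_forall fun y => ?_)
    simp only [kdiff]
    ring

lemma cauchyT_im_nonpos (F : ℝ → ℝ) (hF : Integrable F) (h0 : ∀ᵐ x, 0 ≤ F x) (z : ℂ)
    (hz : 0 < z.im) : (cauchyT F z).im ≤ 0 := by
  have := cauchyT_im F hF z.re z.im hz
  rw [Complex.re_add_im] at this
  rw [this]
  have hpi := Real.pi_pos
  have : 0 ≤ ∫ t, F t * (z.im / ((z.re - t) ^ 2 + z.im ^ 2)) := by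
    refine integral_nonneg_of_ae ?_
    filter_upwards [h0] with t ht
    have : 0 ≤ z.im / ((z.re - t) ^ 2 + z.im ^ 2) := by positivity
    exact mul_nonneg ht this
  have : 0 ≤ 1 / Real.pi * ∫ t, F t * (z.im / ((z.re - t) ^ 2 + z.im ^ 2)) := by positivity
  linarith

lemma cauchyT_differentiableAt (F : ℝ → ℝ) (hF : Integrable F) (z : ℂ)
    (hz : 0 < z.im) : DifferentiableAt ℂ (cauchyT F) z := by
  have hs : {w : ℂ | z.im / 2 < w.im} ∈ 𝓝 z :=
    (isOpen_lt continuous_const Complex.continuous_im).mem_nhds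
      (by change z.im / 2 < z.im; linarith)
  have hfun : ∀ w : ℂ, 0 < w.im → Continuous (fun t : ℝ => (w - t : ℂ)⁻¹) := fun w hw =>
    Continuous.inv₀ (by fun_prop) (sub_ofReal_ne w hw)
  have h := hasDerivAt_integral_of_dominated_loc_of_deriv_le (𝕜 := ℂ) (μ := (volume : Measure ℝ))
    (F := fun w t => (F t : ℂ) / (w - t)) (F' := fun w t => -((F t : ℂ) * ((w - t)⁻¹) ^ 2))
    (bound := fun t => |F t| * ((z.im / 2)⁻¹) ^ 2) hs ?_ (integrable_cauchy F hF z hz) ?_ ?_ ?_ ?_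
  · exact (h.2.differentiableAt).const_mul _
  · filter_upwards [hs] with w hw
    have hw : z.im / 2 < w.im := hw
    exact (integrable_cauchy F hF w (by linarith)).aestronglyMeasurable
  · exact (hF.ofReal.aestronglyMeasurable.mul
      ((hfun z hz).pow 2).aestronglyMeasurable).neg
  · refine Eventually.of_forall fun t w hw => ?_
    have hw : z.im / 2 < w.im := hw
    rw [norm_neg, norm_mul, norm_pow, norm_inv, Complex.norm_real, Real.norm_eq_abs]
    have h1 := im_le_norm_sub w t
    have h2 : ‖w - t‖⁻¹ ≤ (z.im / 2)⁻¹ := inv_anti₀ (by linarith) (by linarith)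
    gcongr
  · exact hF.abs.mul_const _
  · refine Eventually.of_forall fun t w hw => ?_
    have hw : z.im / 2 < w.im := hw
    have hne := sub_ofReal_ne w (by linarith) t
    have h1 : HasDerivAt (fun w : ℂ => w - t) 1 w := (hasDerivAt_id w).sub_const _
    have h2 := (h1.inv hne).const_mul (F t : ℂ)
    simp only [div_eq_mul_inv]
    refine h2.congr_deriv ?_
    field_simp

/-- Null sets pull back to null sets under injective maps with nonvanishing derivative. -/
lemma ae_comp_of_deriv {s : Set ℝ} {f f' : ℝ → ℝ} (hs : MeasurableSet s)
    (hf : ∀ x ∈ s, HasDerivWithinAt f (f' x) s x) (hinj : Set.InjOn f s)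
    (hmf : Measurable f) (hmf' : Measurable f')
    (hne : ∀ x ∈ s, f' x ≠ 0) {P : ℝ → Prop} (hP : ∀ᵐ x ∂(volume : Measure ℝ), P x) :
    ∀ᵐ x ∂(volume.restrict s), P (f x) := by
  obtain ⟨N, hN1, hN2, hN3⟩ := exists_measurable_superset_of_null hP
  have h := lintegral_image_eq_lintegral_abs_deriv_mul hs hf hinj (N.indicator 1)
  have h0 : ∫⁻ x in f '' s, N.indicator 1 x = 0 := by
    rw [lintegral_indicator_one hN2]
    exact le_antisymm ((Measure.restrict_apply_le _ _).trans hN3.le) (zero_le)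
  rw [h0] at h
  have hm : Measurable fun x => ENNReal.ofReal |f' x| * N.indicator (1 : ℝ → ENNReal) (f x) := by
    refine Measurable.mul (by fun_prop) ?_
    exact (measurable_one.indicator hN2).comp hmf
  have h1 := (lintegral_eq_zero_iff hm).1 h.symm
  filter_upwards [h1, ae_restrict_mem hs] with x hx hxs
  by_contra hcon
  have hxN : f x ∈ N := hN1 hcon
  simp only [Set.indicator_of_mem hxN, Pi.one_apply, mul_one, Pi.zero_apply,
    ENNReal.ofReal_eq_zero] at hx
  exact hne x hxs (abs_nonpos_iff.1 hx)

lemma line_continuous {H : ℂ → ℂ} (hd : ∀ z : ℂ, 0 < z.im → DifferentiableAt ℂ H z)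
    {δ : ℝ} (hδ : 0 < δ) : Continuous fun x : ℝ => H ((x : ℂ) + δ * Complex.I) := by
  rw [continuous_iff_continuousAt]
  intro x
  have h1 : ContinuousAt H ((x : ℂ) + δ * Complex.I) :=
    (hd _ (by simpa using hδ)).continuousAt
  exact ContinuousAt.comp (f := fun x : ℝ => (x : ℂ) + δ * Complex.I) h1
    (by fun_prop)

lemma cos_half_im (ζ : ℂ) (h1 : 0 ≤ ζ.re) (h2 : ζ.re ≤ Real.pi) (h3 : ζ.im ≤ 0) :
    0 ≤ (Complex.cos ζ / 2).im := by
  have h : Complex.cos ζ = Complex.cos ζ.re * Complex.cosh ζ.im -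
      Complex.sin ζ.re * Complex.sinh ζ.im * Complex.I := by
    conv_lhs => rw [← Complex.re_add_im ζ]
    rw [Complex.cos_add_mul_I]
  have h4 : (Complex.cos ζ).im = -(Real.sin ζ.re * Real.sinh ζ.im) := by
    rw [h, ← Complex.ofReal_cos, ← Complex.ofReal_sin, ← Complex.ofReal_cosh,
      ← Complex.ofReal_sinh]
    simp only [Complex.sub_im, Complex.mul_im, Complex.mul_re, Complex.ofReal_re,
      Complex.ofReal_im, Complex.I_re, Complex.I_im]
    ring
  have h5 : (Complex.cos ζ / 2).im = (Complex.cos ζ).im / 2 := by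
    simp
  rw [h5, h4]
  have := Real.sin_nonneg_of_nonneg_of_le_pi h1 h2
  have h6 : Real.sinh ζ.im ≤ 0 := Real.sinh_nonpos_iff.2 h3
  nlinarith

lemma contour {H : ℂ → ℂ} (hd : ∀ z : ℂ, 0 < z.im → DifferentiableAt ℂ H z)
    (hb : ∀ z : ℂ, 0 < z.im → ‖H z‖ ≤ 2) {δ T : ℝ} (hδ : 0 < δ) (hT : 0 ≤ T) :
    ‖(∫ θ in (0 : ℝ)..Real.pi, H (((Real.cos θ / 2 : ℝ) : ℂ) + δ * Complex.I) *
        (Complex.I * Complex.exp (-(Complex.I * θ)))) -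
      ∫ y in (-T)..0, (H (((-(Real.cosh y / 2) : ℝ) : ℂ) + δ * Complex.I) +
        H (((Real.cosh y / 2 : ℝ) : ℂ) + δ * Complex.I)) * Real.exp y‖
      ≤ 2 * Real.pi * Real.exp (-T) := by
  set f : ℂ → ℂ := fun ζ => H (Complex.cos ζ / 2 + δ * Complex.I) *
    (Complex.I * Complex.exp (-(Complex.I * ζ))) with hf
  have him : ∀ ζ : ℂ, 0 ≤ ζ.re → ζ.re ≤ Real.pi → ζ.im ≤ 0 →
      0 < (Complex.cos ζ / 2 + δ * Complex.I).im := by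
    intro ζ h1 h2 h3
    have := cos_half_im ζ h1 h2 h3
    rw [Complex.add_im]
    simp only [Complex.mul_im, Complex.ofReal_re, Complex.I_im, Complex.ofReal_im, Complex.I_re]
    linarith
  have hdf : DifferentiableOn ℂ f
      (Set.uIcc (-(T : ℂ) * Complex.I).re (Real.pi : ℂ).re ×ℂ
        Set.uIcc (-(T : ℂ) * Complex.I).im (Real.pi : ℂ).im) := by
    intro ζ hζ
    rw [Complex.mem_reProdIm] at hζ
    simp only [neg_mul, Complex.neg_re, Complex.mul_re, Complex.ofReal_re, Complex.I_re, mul_zero,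
      Complex.ofReal_im, Complex.I_im, mul_one, sub_self, neg_zero, Complex.neg_im, Complex.mul_im,
      add_zero] at hζ
    rw [Set.uIcc_of_le Real.pi_pos.le, Set.uIcc_of_le (by linarith)] at hζ
    obtain ⟨⟨h1, h2⟩, h3, h4⟩ := hζ
    apply DifferentiableAt.differentiableWithinAt
    have h5 := hd _ (him ζ h1 h2 h4)
    have h6 : DifferentiableAt ℂ (fun ζ => H (Complex.cos ζ / 2 + δ * Complex.I)) ζ :=
      DifferentiableAt.comp (g := H) (f := fun ζ => Complex.cos ζ / 2 + δ * Complex.I) ζ h5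
        (by fun_prop)
    exact h6.mul (by fun_prop)
  have hrect := Complex.integral_boundary_rect_eq_zero_of_differentiableOn f _ _ hdf
  simp only [neg_mul, Complex.neg_re, Complex.mul_re, Complex.ofReal_re, Complex.I_re, mul_zero,
      Complex.ofReal_im, Complex.I_im, mul_one, sub_self, neg_zero, Complex.neg_im, Complex.mul_im,
      add_zero, Complex.ofReal_zero, zero_mul, zero_add, smul_eq_mul] at hrect
  have e1 : ∀ θ : ℝ, f θ = H (((Real.cos θ / 2 : ℝ) : ℂ) + δ * Complex.I) *
        (Complex.I * Complex.exp (-(Complex.I * θ))) := by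
    intro θ
    simp only [hf]
    push_cast
    rfl
  have e2 : ∀ y : ℝ, f (y * Complex.I) = Complex.I *
      (H (((Real.cosh y / 2 : ℝ) : ℂ) + δ * Complex.I) * Real.exp y) := by
    intro y
    simp only [hf]
    rw [Complex.cos_mul_I]
    have : -(Complex.I * (y * Complex.I)) = (y : ℂ) := by
      linear_combination (-(y : ℂ)) * Complex.I_mul_I
    rw [this]
    push_cast
    ring
  have e3 : ∀ y : ℝ, f (Real.pi + y * Complex.I) = -(Complex.I *
      (H (((-(Real.cosh y / 2) : ℝ) : ℂ) + δ * Complex.I) * Real.exp y)) := by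
    intro y
    simp only [hf]
    have h1 : Complex.cos (Real.pi + y * Complex.I) = - Complex.cosh y := by
      rw [add_comm, Complex.cos_add_pi, Complex.cos_mul_I]
    have h2 : Complex.exp (-(Complex.I * (Real.pi + y * Complex.I))) = - Complex.exp y := by
      have : -(Complex.I * (Real.pi + y * Complex.I)) = (y : ℂ) - Real.pi * Complex.I := by
        linear_combination (-(y : ℂ)) * Complex.I_mul_I
      rw [this, Complex.exp_sub, Complex.exp_pi_mul_I, div_neg, div_one]
    rw [h1, h2]
    push_cast
    rw [neg_div]
    ring
  have hcu := line_continuous hd hδ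
  simp_rw [e1, e2, e3] at hrect
  rw [intervalIntegral.integral_neg, intervalIntegral.integral_const_mul,
    intervalIntegral.integral_const_mul] at hrect
  have hsplit : ∫ y in (-T)..0, (H (((-(Real.cosh y / 2) : ℝ) : ℂ) + δ * Complex.I) +
        H (((Real.cosh y / 2 : ℝ) : ℂ) + δ * Complex.I)) * Real.exp y =
      (∫ y in (-T)..0, H (((-(Real.cosh y / 2) : ℝ) : ℂ) + δ * Complex.I) * Real.exp y) +
      ∫ y in (-T)..0, H (((Real.cosh y / 2 : ℝ) : ℂ) + δ * Complex.I) * Real.exp y := by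
    simp only [add_mul]
    refine intervalIntegral.integral_add ?_ ?_
    · refine Continuous.intervalIntegrable ?_ _ _
      exact (hcu.comp (by fun_prop : Continuous fun y : ℝ => -(Real.cosh y / 2))).mul
        (by fun_prop)
    · refine Continuous.intervalIntegrable ?_ _ _
      exact (hcu.comp (by fun_prop : Continuous fun y : ℝ => (Real.cosh y / 2))).mul
        (by fun_prop)
  rw [hsplit]
  generalize (∫ y in (-T)..0, H (((-(Real.cosh y / 2) : ℝ) : ℂ) + δ * Complex.I) * Real.exp y) = S1
    at *
  generalize (∫ y in (-T)..0, H (((Real.cosh y / 2 : ℝ) : ℂ) + δ * Complex.I) * Real.exp y) = S2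
    at *
  have hbot : ‖∫ x in (0 : ℝ)..Real.pi, f (x + ((-T : ℝ) : ℂ) * Complex.I)‖ ≤
      2 * Real.exp (-T) * |Real.pi - 0| := by
    refine intervalIntegral.norm_integral_le_of_norm_le_const fun x hx => ?_
    rw [Set.uIoc_of_le Real.pi_pos.le] at hx
    simp only [hf]
    rw [norm_mul, norm_mul, Complex.norm_I, one_mul, Complex.norm_exp]
    have h1 := hb _ (him (x + ((-T : ℝ) : ℂ) * Complex.I) (by simpa using hx.1.le)
      (by simpa using hx.2) (by simpa using hT))
    have h2 : (-(Complex.I * ((x : ℂ) + ((-T : ℝ) : ℂ) * Complex.I))).re = -T := by simp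
    rw [h2]
    gcongr
  rw [sub_zero, abs_of_pos Real.pi_pos] at hbot
  generalize (∫ x in (0 : ℝ)..Real.pi, f (x + ((-T : ℝ) : ℂ) * Complex.I)) = Bt at *
  generalize (∫ θ in (0 : ℝ)..Real.pi, H (((Real.cos θ / 2 : ℝ) : ℂ) + δ * Complex.I) *
        (Complex.I * Complex.exp (-(Complex.I * θ)))) = Tp at *
  have : Tp - (S1 + S2) = Bt := by
    linear_combination (-1 : ℂ) * hrect + (-(S1 + S2)) * Complex.I_mul_I
  rw [this]
  linarith

lemma ae_cos {P : ℝ → Prop} (hP : ∀ᵐ x ∂(volume : Measure ℝ), P x) :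
    ∀ᵐ θ ∂(volume.restrict (Set.Ioc 0 Real.pi)), P (Real.cos θ / 2) := by
  rw [← restrict_Ioo_eq_restrict_Ioc]
  refine ae_comp_of_deriv (f := fun θ => Real.cos θ / 2) (f' := fun θ => -Real.sin θ / 2)
    measurableSet_Ioo (fun x _ => ((Real.hasDerivAt_cos x).div_const 2).hasDerivWithinAt) ?_
    (by fun_prop) (by fun_prop) ?_ hP
  · intro a ha b hb hab
    exact Real.injOn_cos ⟨ha.1.le, ha.2.le⟩ ⟨hb.1.le, hb.2.le⟩ (by simpa using hab)
  · intro x hx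
    have := Real.sin_pos_of_pos_of_lt_pi hx.1 hx.2
    simp only [ne_eq]
    intro h
    linarith

lemma ae_cosh (T : ℝ) {P : ℝ → Prop} (hP : ∀ᵐ x ∂(volume : Measure ℝ), P x) :
    ∀ᵐ y ∂(volume.restrict (Set.Ioc (-T) 0)), P (Real.cosh y / 2) := by
  rw [← restrict_Ioo_eq_restrict_Ioc]
  refine ae_comp_of_deriv (f := fun θ => Real.cosh θ / 2) (f' := fun θ => Real.sinh θ / 2)
    measurableSet_Ioo (fun x _ => ((Real.hasDerivAt_cosh x).div_const 2).hasDerivWithinAt) ?_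
    (by fun_prop) (by fun_prop) ?_ hP
  · intro a ha b hb hab
    have h : Real.cosh a = Real.cosh b := by simpa using hab
    have h3 : |a| = |b| :=
      le_antisymm (Real.cosh_le_cosh.1 h.le) (Real.cosh_le_cosh.1 h.ge)
    rw [abs_of_neg ha.2, abs_of_neg hb.2] at h3
    linarith
  · intro x hx
    have := Real.sinh_neg_iff.2 hx.2
    simp only [ne_eq]
    intro h
    linarith

lemma contour_lim {H : ℂ → ℂ} (hd : ∀ z : ℂ, 0 < z.im → DifferentiableAt ℂ H z)
    (hb : ∀ z : ℂ, 0 < z.im → ‖H z‖ ≤ 2) {T : ℝ} (hT : 0 ≤ T) (h0 : ℝ → ℂ)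
    (hlim : ∀ᵐ x : ℝ, Tendsto (fun δ : ℝ => H ((x : ℂ) + δ * Complex.I)) (𝓝[>] 0) (𝓝 (h0 x))) :
    ‖(∫ θ in (0 : ℝ)..Real.pi, h0 (Real.cos θ / 2) *
        (Complex.I * Complex.exp (-(Complex.I * θ)))) -
      ∫ y in (-T)..0, (h0 (-(Real.cosh y / 2)) + h0 (Real.cosh y / 2)) * Real.exp y‖
      ≤ 2 * Real.pi * Real.exp (-T) ∧
    AEStronglyMeasurable (fun θ => h0 (Real.cos θ / 2)) (volume.restrict (Set.Ioc 0 Real.pi)) ∧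
    AEStronglyMeasurable (fun y => h0 (-(Real.cosh y / 2)) + h0 (Real.cosh y / 2))
      (volume.restrict (Set.Ioc (-T) 0)) := by
  have l1 := ae_cos hlim
  have l2 := ae_cosh T hlim
  have hlim' : ∀ᵐ x : ℝ, Tendsto (fun δ : ℝ => H (((-x : ℝ) : ℂ) + δ * Complex.I)) (𝓝[>] 0)
      (𝓝 (h0 (-x))) :=
    (Measure.measurePreserving_neg (volume : Measure ℝ)).quasiMeasurePreserving.ae hlim
  have l3 := ae_cosh T hlim'
  -- sequence
  set d : ℕ → ℝ := fun n => 1 / ((n : ℝ) + 1) with hdd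
  have hd0 : ∀ n, 0 < d n := fun n => by positivity
  have hdt : Tendsto d atTop (𝓝[>] 0) :=
    tendsto_nhdsWithin_iff.2 ⟨tendsto_one_div_add_atTop_nhds_zero_nat,
      Eventually.of_forall fun n => hd0 n⟩
  have hcu : ∀ n, Continuous fun x : ℝ => H ((x : ℂ) + (d n : ℝ) * Complex.I) :=
    fun n => line_continuous hd (hd0 n)
  have hbb : ∀ n (x : ℝ), ‖H ((x : ℂ) + (d n : ℝ) * Complex.I)‖ ≤ 2 :=
    fun n x => hb _ (by simpa using hd0 n)
  have c1 : ∀ n, Continuous fun θ : ℝ => H (((Real.cos θ / 2 : ℝ) : ℂ) + (d n : ℝ) * Complex.I) :=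
    fun n => (hcu n).comp (by fun_prop : Continuous fun y : ℝ => Real.cos y / 2)
  have c2 : ∀ n, Continuous fun y : ℝ => H (((Real.cosh y / 2 : ℝ) : ℂ) + (d n : ℝ) * Complex.I) :=
    fun n => (hcu n).comp (by fun_prop : Continuous fun y : ℝ => Real.cosh y / 2)
  have c3 : ∀ n, Continuous fun y : ℝ =>
      H (((-(Real.cosh y / 2) : ℝ) : ℂ) + (d n : ℝ) * Complex.I) :=
    fun n => (hcu n).comp (by fun_prop : Continuous fun y : ℝ => -(Real.cosh y / 2))
  have t1 : ∀ᵐ θ ∂(volume.restrict (Set.Ioc 0 Real.pi)), Tendsto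
      (fun n => H (((Real.cos θ / 2 : ℝ) : ℂ) + (d n : ℝ) * Complex.I)) atTop
      (𝓝 (h0 (Real.cos θ / 2))) := by
    filter_upwards [l1] with θ h using h.comp hdt
  have t2 : ∀ᵐ y ∂(volume.restrict (Set.Ioc (-T) 0)), Tendsto
      (fun n => H (((-(Real.cosh y / 2) : ℝ) : ℂ) + (d n : ℝ) * Complex.I) +
        H (((Real.cosh y / 2 : ℝ) : ℂ) + (d n : ℝ) * Complex.I)) atTop
      (𝓝 (h0 (-(Real.cosh y / 2)) + h0 (Real.cosh y / 2))) := by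
    filter_upwards [l2, l3] with y h h' using (h'.comp hdt).add (h.comp hdt)
  refine ⟨?_, ?_, ?_⟩
  · have T1 : Tendsto (fun n => ∫ θ in (0 : ℝ)..Real.pi,
        H (((Real.cos θ / 2 : ℝ) : ℂ) + (d n : ℝ) * Complex.I) *
        (Complex.I * Complex.exp (-(Complex.I * θ)))) atTop (𝓝 (∫ θ in (0 : ℝ)..Real.pi,
        h0 (Real.cos θ / 2) * (Complex.I * Complex.exp (-(Complex.I * θ))))) := by
      refine intervalIntegral.tendsto_integral_filter_of_dominated_convergence (fun _ => 2) ?_ ?_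
        (intervalIntegrable_const) ?_
      · refine Eventually.of_forall fun n => ?_
        exact ((c1 n).mul (by fun_prop)).aestronglyMeasurable
      · refine Eventually.of_forall fun n => Eventually.of_forall fun θ _ => ?_
        rw [norm_mul, norm_mul, Complex.norm_I, one_mul, Complex.norm_exp]
        have h2 : (-(Complex.I * (θ : ℂ))).re = 0 := by simp
        rw [h2, Real.exp_zero, mul_one]
        exact hbb n _
      · rw [Set.uIoc_of_le Real.pi_pos.le]
        rw [ae_restrict_iff' measurableSet_Ioc] at t1
        filter_upwards [t1] with θ h hθ using (h hθ).mul_const _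
    have T2 : Tendsto (fun n => ∫ y in (-T)..0,
        (H (((-(Real.cosh y / 2) : ℝ) : ℂ) + (d n : ℝ) * Complex.I) +
        H (((Real.cosh y / 2 : ℝ) : ℂ) + (d n : ℝ) * Complex.I)) * Real.exp y) atTop
        (𝓝 (∫ y in (-T)..0, (h0 (-(Real.cosh y / 2)) + h0 (Real.cosh y / 2)) * Real.exp y)) := by
      refine intervalIntegral.tendsto_integral_filter_of_dominated_convergence
        (fun y => 4 * Real.exp y) ?_ ?_
        (Continuous.intervalIntegrable (by fun_prop) _ _) ?_
      · refine Eventually.of_forall fun n => ?_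
        exact (((c3 n).add (c2 n)).mul (by fun_prop)).aestronglyMeasurable
      · refine Eventually.of_forall fun n => Eventually.of_forall fun y _ => ?_
        rw [norm_mul, Complex.norm_real, Real.norm_of_nonneg (Real.exp_pos y).le]
        have h1 := norm_add_le (H (((-(Real.cosh y / 2) : ℝ) : ℂ) + (d n : ℝ) * Complex.I))
          (H (((Real.cosh y / 2 : ℝ) : ℂ) + (d n : ℝ) * Complex.I))
        have h2 := hbb n (-(Real.cosh y / 2))
        have h3 := hbb n (Real.cosh y / 2)
        gcongr
        linarith
      · rw [Set.uIoc_of_le (by linarith)]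
        rw [ae_restrict_iff' measurableSet_Ioc] at t2
        filter_upwards [t2] with y h hy using (h hy).mul_const _
    exact le_of_tendsto' (T1.sub T2).norm fun n => contour hd hb (hd0 n) hT
  · exact aestronglyMeasurable_of_tendsto_ae atTop (fun n => (c1 n).aestronglyMeasurable) t1
  · exact aestronglyMeasurable_of_tendsto_ae atTop
      (fun n => ((c3 n).add (c2 n)).aestronglyMeasurable) t2

lemma bdry_lim (F G : ℝ → ℝ) (hF : Integrable F)
    (hG : ∀ᵐ x ∂(volume : Measure ℝ), pvHilbAt F x (G x)) :
    ∀ᵐ x : ℝ, Tendsto (fun δ : ℝ => cauchyT F ((x : ℂ) + δ * Complex.I)) (𝓝[>] 0)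
      (𝓝 ((G x : ℂ) - F x * Complex.I)) := by
  filter_upwards [ct_ae F hF, hG] with x h1 h2
  have hre : Tendsto (fun δ : ℝ => (cauchyT F ((x : ℂ) + δ * Complex.I)).re) (𝓝[>] 0)
      (𝓝 (G x)) := by
    have h2' : Tendsto _ _ _ := h2
    simpa using h1.2.add h2'
  have a := (Complex.continuous_ofReal.tendsto _).comp hre
  have b := ((Complex.continuous_ofReal.tendsto _).comp h1.1).mul_const Complex.I
  have c := a.add b
  simp only [Function.comp_def, Complex.re_add_im] at c
  convert c using 2
  push_cast
  ring

lemma integral_abs_cos : ∫ θ in (0 : ℝ)..Real.pi, |Real.cos θ| = 2 := by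
  have hpi := Real.pi_pos
  have hc : Continuous fun θ : ℝ => |Real.cos θ| := by fun_prop
  rw [← intervalIntegral.integral_add_adjacent_intervals (b := Real.pi / 2)
    (hc.intervalIntegrable _ _) (hc.intervalIntegrable _ _)]
  have h1 : ∫ θ in (0 : ℝ)..(Real.pi / 2), |Real.cos θ| = ∫ θ in (0 : ℝ)..(Real.pi / 2),
      Real.cos θ := by
    refine intervalIntegral.integral_congr fun θ hθ => ?_
    rw [Set.uIcc_of_le (by positivity)] at hθ
    exact abs_of_nonneg (Real.cos_nonneg_of_mem_Icc ⟨by linarith [hθ.1], hθ.2⟩)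
  have h2 : ∫ θ in (Real.pi / 2)..Real.pi, |Real.cos θ| = ∫ θ in (Real.pi / 2)..Real.pi,
      -Real.cos θ := by
    refine intervalIntegral.integral_congr fun θ hθ => ?_
    rw [Set.uIcc_of_le (by linarith)] at hθ
    exact abs_of_nonpos (Real.cos_nonpos_of_pi_div_two_le_of_le hθ.1 (by linarith [hθ.2]))
  rw [h1, h2, intervalIntegral.integral_neg, integral_cos, integral_cos]
  simp
  norm_num

lemma supp_ae {F : ℝ → ℝ} (hF : memAstar F) :
    ∀ᵐ x ∂(volume : Measure ℝ), x ∉ Set.Ioo (-(1 / 2) : ℝ) (1 / 2) → F x = 0 := by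
  have e1 : ∀ᵐ x ∂(volume : Measure ℝ), x ≠ 1 / 2 := by simp [ae_iff]
  have e2 : ∀ᵐ x ∂(volume : Measure ℝ), x ≠ -(1 / 2) := by simp [ae_iff]
  filter_upwards [hF.2.2, e1, e2] with x hx h1 h2 hn
  apply hx
  intro h
  exact hn ⟨lt_of_le_of_ne h.1 h2.symm, lt_of_le_of_ne h.2 h1⟩

lemma main_lam (F G : ℝ → ℝ) (hF : memAstar F)
    (hG : ∀ᵐ x ∂(volume : Measure ℝ), pvHilbAt F x (G x)) (M : ℝ)
    (hM : ∀ᵐ x ∂(volume : Measure ℝ), |G x| ≤ M) (l : ℝ) (hl : 0 < l) :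
    ∫ θ in Set.Ioc 0 Real.pi, (1 - Real.exp (-(l * F (Real.cos θ / 2)))) * Real.sin θ ≤
      2 * l * M + l ^ 2 * M ^ 2 := by
  have hpi := Real.pi_pos
  have hM0 : 0 ≤ M := by
    obtain ⟨x, hx⟩ := hM.exists
    exact (abs_nonneg _).trans hx
  set H : ℂ → ℂ := fun z => 1 - Complex.exp (-(Complex.I * l * cauchyT F z)) with hH
  set h0 : ℝ → ℂ := fun x => 1 - Complex.exp (-(Complex.I * l * ((G x : ℂ) - F x * Complex.I)))
    with hh0
  have hd : ∀ z : ℂ, 0 < z.im → DifferentiableAt ℂ H z := by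
    intro z hz
    have := cauchyT_differentiableAt F hF.1 z hz
    simp only [hH]
    fun_prop
  have hb : ∀ z : ℂ, 0 < z.im → ‖H z‖ ≤ 2 := by
    intro z hz
    have h1 := cauchyT_im_nonpos F hF.1 hF.2.1 z hz
    refine (norm_sub_le _ _).trans ?_
    rw [norm_one, Complex.norm_exp]
    have h2 : (-(Complex.I * l * cauchyT F z)).re = l * (cauchyT F z).im := by simp
    rw [h2]
    have : Real.exp (l * (cauchyT F z).im) ≤ 1 := Real.exp_le_one_iff.2 (by nlinarith)
    linarith
  have hlim : ∀ᵐ x : ℝ, Tendsto (fun δ : ℝ => H ((x : ℂ) + δ * Complex.I)) (𝓝[>] 0)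
      (𝓝 (h0 x)) := by
    filter_upwards [bdry_lim F G hF.1 hG] with x hx
    have hc : Continuous fun z : ℂ => 1 - Complex.exp (-(Complex.I * l * z)) := by fun_prop
    exact (hc.tendsto _).comp hx
  have hre0 : ∀ x, (h0 x).re = 1 - Real.exp (-(l * F x)) * Real.cos (l * G x) := by
    intro x
    simp [hh0, Complex.exp_re]
  have him0 : ∀ x, (h0 x).im = Real.exp (-(l * F x)) * Real.sin (l * G x) := by
    intro x
    simp [hh0, Complex.exp_im]
  have hnorm0 : ∀ x, ‖1 - h0 x‖ = Real.exp (-(l * F x)) := by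
    intro x
    simp [hh0, Complex.norm_exp]
  have hb0 : ∀ᵐ x : ℝ, ‖h0 x‖ ≤ 2 := by
    filter_upwards [hF.2.1] with x hx
    have h1 : h0 x = 1 - (1 - h0 x) := by ring
    rw [h1]
    refine (norm_sub_le _ _).trans ?_
    rw [hnorm0, norm_one]
    have : Real.exp (-(l * F x)) ≤ 1 := Real.exp_le_one_iff.2 (by
      have := mul_nonneg hl.le hx
      linarith)
    linarith
  -- the estimate for fixed `T`
  have hfix : ∀ T : ℝ, 0 ≤ T →
      ∫ θ in Set.Ioc 0 Real.pi, (1 - Real.exp (-(l * F (Real.cos θ / 2)))) * Real.sin θ ≤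
      2 * l * M + l ^ 2 * M ^ 2 + 2 * Real.pi * Real.exp (-T) := by
    intro T hT
    obtain ⟨hc, hm1, hm2⟩ := contour_lim hd hb hT h0 hlim
    rw [intervalIntegral.integral_of_le hpi.le, intervalIntegral.integral_of_le (by linarith)]
      at hc
    set μ := (volume : Measure ℝ).restrict (Set.Ioc 0 Real.pi) with hμ
    set ν := (volume : Measure ℝ).restrict (Set.Ioc (-T) 0) with hν
    have hk : Continuous fun θ : ℝ => Complex.I * Complex.exp (-(Complex.I * θ)) := by fun_prop
    have hkn : ∀ θ : ℝ, ‖Complex.I * Complex.exp (-(Complex.I * θ))‖ = 1 := by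
      intro θ
      rw [norm_mul, Complex.norm_I, one_mul, Complex.norm_exp]
      simp
    have i1 : Integrable (fun θ : ℝ => h0 (Real.cos θ / 2) *
        (Complex.I * Complex.exp (-(Complex.I * θ)))) μ := by
      refine Integrable.of_bound (hm1.mul hk.aestronglyMeasurable) 2 ?_
      filter_upwards [ae_cos hb0] with θ h
      rw [norm_mul, hkn, mul_one]
      exact h
    have hb0' : ∀ᵐ x : ℝ, ‖h0 (-x)‖ ≤ 2 :=
      (Measure.measurePreserving_neg (volume : Measure ℝ)).quasiMeasurePreserving.ae hb0
    have i2 : Integrable (fun y : ℝ => (h0 (-(Real.cosh y / 2)) + h0 (Real.cosh y / 2)) *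
        Real.exp y) ν := by
      refine Integrable.of_bound (hm2.mul (by fun_prop)) 4 ?_
      filter_upwards [ae_cosh T hb0, ae_cosh T hb0', ae_restrict_mem measurableSet_Ioc]
        with y h h' hy
      rw [norm_mul, Complex.norm_real, Real.norm_of_nonneg (Real.exp_pos y).le]
      have h1 := norm_add_le (h0 (-(Real.cosh y / 2))) (h0 (Real.cosh y / 2))
      have h2 : Real.exp y ≤ 1 := Real.exp_le_one_iff.2 hy.2
      have h3 := norm_nonneg (h0 (-(Real.cosh y / 2)) + h0 (Real.cosh y / 2))
      have h4 := Real.exp_pos y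
      nlinarith
    have hre : (∫ θ, h0 (Real.cos θ / 2) * (Complex.I * Complex.exp (-(Complex.I * θ))) ∂μ).re ≤
        (∫ y, (h0 (-(Real.cosh y / 2)) + h0 (Real.cosh y / 2)) * Real.exp y ∂ν).re +
          2 * Real.pi * Real.exp (-T) := by
      have := (Complex.re_le_norm _).trans hc
      rw [Complex.sub_re] at this
      linarith
    have r1 : (∫ θ, h0 (Real.cos θ / 2) * (Complex.I * Complex.exp (-(Complex.I * θ))) ∂μ).re =
        ∫ θ, (h0 (Real.cos θ / 2) * (Complex.I * Complex.exp (-(Complex.I * θ)))).re ∂μ :=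
      (integral_re i1).symm
    have r2 : (∫ y, (h0 (-(Real.cosh y / 2)) + h0 (Real.cosh y / 2)) * Real.exp y ∂ν).re =
        ∫ y, ((h0 (-(Real.cosh y / 2)) + h0 (Real.cosh y / 2)) * Real.exp y).re ∂ν :=
      (integral_re i2).symm
    -- sides
    have hside : ∀ᵐ x : ℝ, (x ∉ Set.Ioo (-(1 / 2) : ℝ) (1 / 2) → (h0 x).re ≤ l ^ 2 * M ^ 2 / 2) := by
      filter_upwards [supp_ae hF, hM] with x hx hMx hn
      rw [hre0, hx hn, mul_zero, neg_zero, Real.exp_zero, one_mul]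
      have := Real.one_sub_sq_div_two_le_cos (x := l * G x)
      have h2 : G x ^ 2 ≤ M ^ 2 := sq_le_sq' (abs_le.1 hMx).1 (abs_le.1 hMx).2
      have h3 : l ^ 2 * G x ^ 2 ≤ l ^ 2 * M ^ 2 := by gcongr
      rw [mul_pow] at this
      linarith
    have hside' : ∀ᵐ x : ℝ, (-x ∉ Set.Ioo (-(1 / 2) : ℝ) (1 / 2) →
        (h0 (-x)).re ≤ l ^ 2 * M ^ 2 / 2) :=
      (Measure.measurePreserving_neg (volume : Measure ℝ)).quasiMeasurePreserving.ae hside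
    have s2 : ∫ y, ((h0 (-(Real.cosh y / 2)) + h0 (Real.cosh y / 2)) * Real.exp y).re ∂ν ≤
        l ^ 2 * M ^ 2 := by
      have ie : Integrable (fun y => l ^ 2 * M ^ 2 * Real.exp y) ν :=
        (Continuous.integrableOn_Ioc (by fun_prop))
      calc _ ≤ ∫ y, l ^ 2 * M ^ 2 * Real.exp y ∂ν := by
            refine integral_mono_ae i2.re ie ?_
            filter_upwards [ae_cosh T hside, ae_cosh T hside'] with y h h'
            have hy := Real.one_le_cosh y
            have a1 := h (fun hh => by linarith [hh.2])
            have a2 := h' (fun hh => by linarith [hh.1])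
            have e : ((h0 (-(Real.cosh y / 2)) + h0 (Real.cosh y / 2)) *
                (Real.exp y : ℂ)).re = ((h0 (-(Real.cosh y / 2))).re +
                (h0 (Real.cosh y / 2)).re) * Real.exp y := by
              rw [Complex.re_mul_ofReal, Complex.add_re]
            refine (le_of_eq e).trans ?_
            gcongr
            linarith
        _ = l ^ 2 * M ^ 2 * (1 - Real.exp (-T)) := by
            rw [integral_const_mul, hν, ← intervalIntegral.integral_of_le (by linarith),
              integral_exp, Real.exp_zero]
        _ ≤ _ := by
            have : 0 ≤ l ^ 2 * M ^ 2 * Real.exp (-T) := by positivity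
            linarith
    -- top
    have hme : AEStronglyMeasurable (fun θ => Real.exp (-(l * F (Real.cos θ / 2)))) μ := by
      have := (aestronglyMeasurable_const.sub hm1 : AEStronglyMeasurable
        (fun θ => 1 - h0 (Real.cos θ / 2)) μ).norm
      simpa only [Pi.sub_apply, hnorm0] using this
    have j1 : Integrable (fun θ => (1 - Real.exp (-(l * F (Real.cos θ / 2)))) * Real.sin θ) μ := by
      refine Integrable.of_bound ((aestronglyMeasurable_const.sub hme).mul
        (Real.continuous_sin.aestronglyMeasurable)) 1 ?_
      filter_upwards [ae_cos hF.2.1] with θ h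
      have e1 : Real.exp (-(l * F (Real.cos θ / 2))) ≤ 1 := Real.exp_le_one_iff.2 (by
        have := mul_nonneg hl.le h
        linarith)
      have e2 := Real.exp_pos (-(l * F (Real.cos θ / 2)))
      rw [norm_mul, Real.norm_eq_abs, Real.norm_eq_abs]
      refine mul_le_one₀ ?_ (abs_nonneg _) (Real.abs_sin_le_one θ)
      rw [abs_le]
      constructor <;> linarith
    have j2 : Integrable (fun θ => l * M * |Real.cos θ|) μ :=
      (Continuous.integrableOn_Ioc (by fun_prop))
    have s1 : (∫ θ, (1 - Real.exp (-(l * F (Real.cos θ / 2)))) * Real.sin θ ∂μ) - l * M * 2 ≤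
        ∫ θ, (h0 (Real.cos θ / 2) * (Complex.I * Complex.exp (-(Complex.I * θ)))).re ∂μ := by
      have e : l * M * 2 = ∫ θ, l * M * |Real.cos θ| ∂μ := by
        rw [integral_const_mul, hμ, ← intervalIntegral.integral_of_le hpi.le, integral_abs_cos]
      rw [e, ← integral_sub j1 j2]
      refine integral_mono_ae (j1.sub j2) i1.re ?_
      filter_upwards [ae_cos hF.2.1, ae_cos hM, ae_restrict_mem measurableSet_Ioc]
        with θ h1 h2 h3
      have hs : 0 ≤ Real.sin θ := Real.sin_nonneg_of_nonneg_of_le_pi h3.1.le h3.2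
      have e : (h0 (Real.cos θ / 2) * (Complex.I * Complex.exp (-(Complex.I * θ)))).re =
          (h0 (Real.cos θ / 2)).re * Real.sin θ - (h0 (Real.cos θ / 2)).im * Real.cos θ := by
        rw [Complex.mul_re]
        simp [Complex.exp_re, Complex.exp_im]
      rw [hre0, him0] at e
      refine le_trans ?_ (le_of_eq e.symm)
      set E := Real.exp (-(l * F (Real.cos θ / 2)))
      set g := G (Real.cos θ / 2)
      have E0 : 0 < E := Real.exp_pos _
      have E1 : E ≤ 1 := Real.exp_le_one_iff.2 (by
        have := mul_nonneg hl.le h1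
        linarith)
      have c1 : E * Real.cos (l * g) ≤ E := by
        have := Real.cos_le_one (l * g)
        nlinarith
      have c2 : (1 - E) * Real.sin θ ≤ (1 - E * Real.cos (l * g)) * Real.sin θ := by
        gcongr
      have c3 : |E * Real.sin (l * g) * Real.cos θ| ≤ l * M * |Real.cos θ| := by
        rw [abs_mul, abs_mul, abs_of_pos E0]
        refine mul_le_mul_of_nonneg_right ?_ (abs_nonneg _)
        have a1 : |Real.sin (l * g)| ≤ |l * g| := Real.abs_sin_le_abs
        rw [abs_mul, abs_of_pos hl] at a1
        have a2 : l * |g| ≤ l * M := by gcongr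
        have a3 := abs_nonneg (Real.sin (l * g))
        nlinarith
      have c4 := (abs_le.1 c3).2
      linarith
    rw [r1, r2] at hre
    linarith
  refine le_of_tendsto_of_tendsto' tendsto_const_nhds (?_ : Tendsto (fun n : ℕ =>
    2 * l * M + l ^ 2 * M ^ 2 + 2 * Real.pi * Real.exp (-(n : ℝ))) atTop _)
    (fun n => hfix n (Nat.cast_nonneg n))
  have : Tendsto (fun n : ℕ => Real.exp (-(n : ℝ))) atTop (𝓝 0) :=
    Real.tendsto_exp_neg_atTop_nhds_zero.comp tendsto_natCast_atTop_atTop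
  simpa using (this.const_mul (2 * Real.pi)).const_add (2 * l * M + l ^ 2 * M ^ 2)

lemma cos_image : (fun θ => Real.cos θ / 2) '' Set.Ioo 0 Real.pi = Set.Ioo (-(1 / 2)) (1 / 2) := by
  ext x
  constructor
  · rintro ⟨θ, hθ, rfl⟩
    have h1 : Real.cos θ < Real.cos 0 :=
      Real.strictAntiOn_cos ⟨le_rfl, Real.pi_pos.le⟩ ⟨hθ.1.le, hθ.2.le⟩ hθ.1
    have h2 : Real.cos Real.pi < Real.cos θ :=
      Real.strictAntiOn_cos ⟨hθ.1.le, hθ.2.le⟩ ⟨Real.pi_pos.le, le_rfl⟩ hθ.2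
    rw [Real.cos_zero] at h1
    rw [Real.cos_pi] at h2
    constructor
    · show -(1 / 2) < Real.cos θ / 2
      linarith
    · show Real.cos θ / 2 < 1 / 2
      linarith
  · rintro ⟨h1, h2⟩
    refine ⟨Real.arccos (2 * x), ⟨Real.arccos_pos.2 (by linarith), ?_⟩, ?_⟩
    · exact Real.arccos_lt_pi.2 (by linarith)
    · simp only
      rw [Real.cos_arccos (by linarith) (by linarith)]
      ring

lemma cos_change {E : Type*} [NormedAddCommGroup E] [NormedSpace ℝ E] (g : ℝ → E) :
    ∫ x in Set.Ioo (-(1 / 2) : ℝ) (1 / 2), g x =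
      ∫ θ in Set.Ioo 0 Real.pi, (Real.sin θ / 2) • g (Real.cos θ / 2) := by
  rw [← cos_image, integral_image_eq_integral_abs_deriv_smul measurableSet_Ioo
    (f' := fun θ => -Real.sin θ / 2)
    (fun x _ => ((Real.hasDerivAt_cos x).div_const 2).hasDerivWithinAt)]
  · refine setIntegral_congr_fun measurableSet_Ioo fun θ hθ => ?_
    have := Real.sin_pos_of_pos_of_lt_pi hθ.1 hθ.2
    rw [neg_div, abs_neg, abs_of_pos (by positivity)]
  · intro a ha b hb hab
    exact Real.injOn_cos ⟨ha.1.le, ha.2.le⟩ ⟨hb.1.le, hb.2.le⟩ (by simpa using hab)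

lemma integral_abs_supp {F : ℝ → ℝ} (hF : memAstar F) :
    ∫ x, |F x| = ∫ x in Set.Ioo (-(1 / 2) : ℝ) (1 / 2), F x := by
  rw [← integral_indicator measurableSet_Ioo]
  refine integral_congr_ae ?_
  filter_upwards [hF.2.1, supp_ae hF] with x h1 h2
  by_cases h : x ∈ Set.Ioo (-(1 / 2) : ℝ) (1 / 2)
  · rw [Set.indicator_of_mem h, abs_of_nonneg h1]
  · rw [Set.indicator_of_notMem h, h2 h, abs_zero]

lemma main_ineq (F G : ℝ → ℝ) (hF : memAstar F)
    (hG : ∀ᵐ x ∂(volume : Measure ℝ), pvHilbAt F x (G x)) (M : ℝ)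
    (hM : ∀ᵐ x ∂(volume : Measure ℝ), |G x| ≤ M) : ∫ x, |F x| ≤ M := by
  rw [integral_abs_supp hF]
  set d : ℕ → ℝ := fun n => 1 / ((n : ℝ) + 1) with hdd
  have hd0 : ∀ n, 0 < d n := fun n => by positivity
  have hdt : Tendsto d atTop (𝓝 0) := tendsto_one_div_add_atTop_nhds_zero_nat
  have hT : Tendsto (fun n => ∫ x in Set.Ioo (-(1 / 2) : ℝ) (1 / 2),
      (1 - Real.exp (-(d n * F x))) / d n) atTop
      (𝓝 (∫ x in Set.Ioo (-(1 / 2) : ℝ) (1 / 2), F x)) := by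
    refine tendsto_integral_of_dominated_convergence (fun x => |F x|) ?_ hF.1.abs.integrableOn
      ?_ ?_
    · intro n
      have hc : Continuous fun y : ℝ => (1 - Real.exp (-(d n * y))) / d n := by fun_prop
      exact hc.comp_aestronglyMeasurable hF.1.aestronglyMeasurable.restrict
    · intro n
      filter_upwards [ae_restrict_of_ae hF.2.1] with x hx
      have h0 := hd0 n
      have h1 := Real.add_one_le_exp (-(d n * F x))
      have h2 : Real.exp (-(d n * F x)) ≤ 1 := Real.exp_le_one_iff.2 (by
        have := mul_nonneg h0.le hx
        linarith)
      rw [Real.norm_of_nonneg (div_nonneg (by linarith) h0.le), div_le_iff₀ h0,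
        abs_of_nonneg hx]
      linarith
    · refine Eventually.of_forall fun x => ?_
      have hder : HasDerivAt (fun t : ℝ => 1 - Real.exp (-(t * F x))) (F x) 0 := by
        have h1 : HasDerivAt (fun t : ℝ => -(t * F x)) (-(1 * F x)) 0 :=
          ((hasDerivAt_id (0 : ℝ)).mul_const (F x)).neg
        have h2 := (h1.exp).const_sub 1
        refine h2.congr_deriv ?_
        simp
      have h3 := hder.tendsto_slope_zero_right.comp (tendsto_nhdsWithin_iff.2
        ⟨hdt, Eventually.of_forall fun n => hd0 n⟩)
      refine h3.congr fun n => ?_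
      simp [Function.comp, div_eq_inv_mul]
  have hU : Tendsto (fun n => M + d n * M ^ 2 / 2) atTop (𝓝 M) := by
    have := ((hdt.mul_const (M ^ 2)).div_const 2).const_add M
    simpa using this
  refine le_of_tendsto_of_tendsto' hT hU fun n => ?_
  have h := main_lam F G hF hG M hM (d n) (hd0 n)
  rw [integral_Ioc_eq_integral_Ioo] at h
  rw [integral_div, cos_change, div_le_iff₀ (hd0 n)]
  have e : ∫ θ in Set.Ioo 0 Real.pi, (Real.sin θ / 2) •
      (1 - Real.exp (-(d n * F (Real.cos θ / 2)))) = (1 / 2) *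
      ∫ θ in Set.Ioo 0 Real.pi, (1 - Real.exp (-(d n * F (Real.cos θ / 2)))) * Real.sin θ := by
    rw [← integral_const_mul]
    refine integral_congr_ae (Eventually.of_forall fun θ => ?_)
    simp only [smul_eq_mul]
    ring
  rw [e]
  nlinarith

noncomputable def qq (r : ℝ) (w : ℂ) : ℂ := (1 + Complex.I * r * w) / (1 - Complex.I * r * w)

noncomputable def AA (r : ℝ) (w : ℂ) : ℂ := -Complex.I * Complex.log (qq r w)

noncomputable def FF (r : ℝ) (x : ℝ) : ℝ :=
  1 / 2 * Real.log ((1 + r ^ 2 + 2 * r * √(1 - 4 * x ^ 2)) / (1 + r ^ 2 - 2 * r * √(1 - 4 * x ^ 2)))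

lemma qq_den {r : ℝ} {w : ℂ} (h : |r| * ‖w‖ < 1) : 1 - Complex.I * r * w ≠ 0 := by
  intro h0
  have : ‖Complex.I * r * w‖ = 1 := by
    rw [← sub_eq_zero.1 h0]
    simp
  rw [norm_mul, norm_mul, Complex.norm_I, Complex.norm_real, one_mul, Real.norm_eq_abs] at this
  linarith

lemma qq_re_pos {r : ℝ} {w : ℂ} (h : |r| * ‖w‖ < 1) : 0 < (qq r w).re := by
  have hd := qq_den h
  have hu : ‖Complex.I * r * w‖ < 1 := by
    rw [norm_mul, norm_mul, Complex.norm_I, Complex.norm_real, one_mul, Real.norm_eq_abs]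
    exact h
  unfold qq
  set u := Complex.I * r * w with hu'
  have hsq : Complex.normSq u < 1 := by
    rw [Complex.normSq_eq_norm_sq]
    have := norm_nonneg u
    nlinarith
  rw [Complex.normSq_apply] at hsq
  have hn : 0 < Complex.normSq (1 - u) := Complex.normSq_pos.2 hd
  rw [Complex.div_re, ← add_div]
  refine div_pos ?_ hn
  simp only [Complex.add_re, Complex.sub_re, Complex.add_im, Complex.sub_im, Complex.one_re,
    Complex.one_im]
  nlinarith

lemma AA_diff {r : ℝ} {w : ℂ} (h : |r| * ‖w‖ < 1) : DifferentiableAt ℂ (AA r) w := by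
  unfold AA
  refine DifferentiableAt.const_mul (DifferentiableAt.clog ?_ (Or.inl (qq_re_pos h))) _
  unfold qq
  exact DifferentiableAt.div (by fun_prop) (by fun_prop) (qq_den h)

lemma AA_zero (r : ℝ) : AA r 0 = 0 := by
  simp [AA, qq]

lemma AA_re_le {r : ℝ} {w : ℂ} (h : |r| * ‖w‖ < 1) : |(AA r w).re| ≤ Real.pi / 2 := by
  have : (AA r w).re = (qq r w).arg := by
    simp [AA, Complex.log_im]
  rw [this]
  exact Complex.abs_arg_le_pi_div_two_iff.2 (qq_re_pos h).le

lemma AA_deriv (r : ℝ) : deriv (AA r) 0 = 2 * r := by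
  have h1 : HasDerivAt (fun w : ℂ => 1 + Complex.I * r * w) (Complex.I * r) 0 := by
    simpa using ((hasDerivAt_id (0 : ℂ)).const_mul (Complex.I * r)).const_add 1
  have h2 : HasDerivAt (fun w : ℂ => 1 - Complex.I * r * w) (-(Complex.I * r)) 0 := by
    simpa using ((hasDerivAt_id (0 : ℂ)).const_mul (Complex.I * r)).const_sub 1
  have h3 : HasDerivAt (qq r) _ 0 := h1.div h2 (by simp)
  have h4 := (h3.clog (Or.inl (qq_re_pos (by simp)))).const_mul (-Complex.I)
  have h5 : deriv (AA r) 0 = _ := h4.deriv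
  rw [h5]
  simp [qq]
  ring_nf
  simp

lemma AA_sub {r θ : ℝ} (hr : 0 < r) (hr1 : r < 1) (h0 : 0 ≤ θ) (hpi : θ ≤ Real.pi) :
    AA r (circleMap 0 1 θ) - AA r (starRingEnd ℂ (circleMap 0 1 θ)) =
      2 * Complex.I * FF r (Real.cos θ / 2) := by
  have hn : |r| * ‖circleMap 0 1 θ‖ < 1 := by
    simp [abs_of_pos hr, hr1]
  have hn' : |r| * ‖starRingEnd ℂ (circleMap 0 1 θ)‖ < 1 := by
    rw [Complex.norm_conj]; exact hn
  have hq : qq r (starRingEnd ℂ (circleMap 0 1 θ)) =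
      (starRingEnd ℂ (qq r (circleMap 0 1 θ)))⁻¹ := by
    simp [qq, inv_div, sub_eq_add_neg]
  have ha : (qq r (circleMap 0 1 θ)).arg ≠ Real.pi := by
    have := Complex.abs_arg_lt_pi_div_two_iff.2 (Or.inl (qq_re_pos hn))
    have h2 := (abs_lt.1 this).2
    intro h
    linarith [Real.pi_pos]
  have ha' : (starRingEnd ℂ (qq r (circleMap 0 1 θ))).arg ≠ Real.pi := by
    rw [Complex.arg_conj, if_neg ha]
    intro h
    have := Complex.abs_arg_lt_pi_div_two_iff.2 (Or.inl (qq_re_pos hn))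
    have h2 := (abs_lt.1 this).1
    linarith [Real.pi_pos]
  have hs : √(1 - 4 * (Real.cos θ / 2) ^ 2) = Real.sin θ := by
    have : 1 - 4 * (Real.cos θ / 2) ^ 2 = Real.sin θ ^ 2 := by
      have := Real.sin_sq_add_cos_sq θ
      linarith
    rw [this, Real.sqrt_sq (Real.sin_nonneg_of_nonneg_of_le_pi h0 hpi)]
  have hF : FF r (Real.cos θ / 2) = -Real.log ‖qq r (circleMap 0 1 θ)‖ := by
    have e1 : Complex.normSq (1 + Complex.I * r * circleMap 0 1 θ) =
        1 + r ^ 2 - 2 * r * Real.sin θ := by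
      rw [Complex.normSq_apply]
      simp [circleMap, Complex.exp_re, Complex.exp_im]
      have := Real.sin_sq_add_cos_sq θ
      linear_combination r ^ 2 * this
    have e2 : Complex.normSq (1 - Complex.I * r * circleMap 0 1 θ) =
        1 + r ^ 2 + 2 * r * Real.sin θ := by
      rw [Complex.normSq_apply]
      simp [circleMap, Complex.exp_re, Complex.exp_im]
      have := Real.sin_sq_add_cos_sq θ
      linear_combination r ^ 2 * this
    have e3 : ‖qq r (circleMap 0 1 θ)‖ ^ 2 = (1 + r ^ 2 - 2 * r * Real.sin θ) /
        (1 + r ^ 2 + 2 * r * Real.sin θ) := by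
      rw [← Complex.normSq_eq_norm_sq, qq, Complex.normSq_div, e1, e2]
    have e4 := Real.log_pow ‖qq r (circleMap 0 1 θ)‖ 2
    rw [e3, ← inv_div, Real.log_inv] at e4
    unfold FF
    rw [hs]
    push_cast at e4
    linarith
  have hl := Complex.add_conj (Complex.log (qq r (circleMap 0 1 θ)))
  rw [Complex.log_re] at hl
  unfold AA
  rw [hq, Complex.log_inv _ ha', Complex.log_conj _ ha, hF]
  push_cast at hl ⊢
  linear_combination (-Complex.I) * hl

lemma circle_ne {w : ℂ} (hw : ‖w‖ < 1) (θ : ℝ) :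
    circleMap 0 1 θ - w ≠ 0 ∧ 1 - w * circleMap 0 1 θ ≠ 0 := by
  have hn : ‖circleMap 0 1 θ‖ = 1 := by simp
  constructor
  · intro h
    rw [sub_eq_zero.1 h] at hn
    linarith
  · intro h
    have : ‖w * circleMap 0 1 θ‖ = 1 := by
      rw [← sub_eq_zero.1 h]
      simp
    rw [norm_mul, hn] at this
    linarith

lemma AA_cauchy {r : ℝ} (hr : 0 < r) (hr1 : r < 1) {w : ℂ} (hw : ‖w‖ < 1) :
    ∫ θ in (0 : ℝ)..2 * Real.pi, AA r (circleMap 0 1 θ) *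
      (1 / (circleMap 0 1 θ - w) - circleMap 0 1 θ / (1 - w * circleMap 0 1 θ)) =
      2 * Real.pi * dslope (AA r) 0 w := by
  have hball : ∀ z ∈ Metric.ball (0 : ℂ) (1 / r), |r| * ‖z‖ < 1 := by
    intro z hz
    rw [mem_ball_zero_iff, lt_div_iff₀ hr] at hz
    rw [abs_of_pos hr]
    linarith
  have hA : DifferentiableOn ℂ (AA r) (Metric.ball 0 (1 / r)) := fun z hz =>
    (AA_diff (hball z hz)).differentiableWithinAt
  have h1r : 1 < 1 / r := (one_lt_div hr).2 hr1
  have hE : DifferentiableOn ℂ (dslope (AA r) 0) (Metric.ball 0 (1 / r)) :=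
    (Complex.differentiableOn_dslope (Metric.ball_mem_nhds 0 (by positivity))).2 hA
  have hsub : Metric.closedBall (0 : ℂ) 1 ⊆ Metric.ball 0 (1 / r) :=
    Metric.closedBall_subset_ball h1r
  have c1 := (hE.mono hsub).diffContOnCl_ball subset_rfl |>.circleIntegral_sub_inv_smul
    (mem_ball_zero_iff.2 hw)
  have hB : DifferentiableOn ℂ (fun z => AA r z / (1 - w * z)) (Metric.closedBall 0 1) := by
    refine (hA.mono hsub).div (by fun_prop) ?_
    intro z hz h
    rw [mem_closedBall_zero_iff] at hz
    have : ‖w * z‖ = 1 := by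
      rw [← sub_eq_zero.1 h]
      simp
    rw [norm_mul] at this
    nlinarith [norm_nonneg w, norm_nonneg z]
  have c2 := (hB.diffContOnCl_ball subset_rfl).circleIntegral_eq_zero zero_le_one
  have hcA : Continuous (fun θ : ℝ => AA r (circleMap 0 1 θ)) :=
    (hA.continuousOn.mono hsub).comp_continuous (continuous_circleMap 0 1) (fun θ => by simp)
  have hc1 : Continuous (fun θ : ℝ => AA r (circleMap 0 1 θ) * (1 / (circleMap 0 1 θ - w))) :=
    hcA.mul (continuous_const.div ((continuous_circleMap 0 1).sub continuous_const)
      (fun θ => (circle_ne hw θ).1))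
  have hc2 : Continuous (fun θ : ℝ => AA r (circleMap 0 1 θ) *
      (circleMap 0 1 θ / (1 - w * circleMap 0 1 θ))) :=
    hcA.mul ((continuous_circleMap 0 1).div
      (continuous_const.sub (continuous_const.mul (continuous_circleMap 0 1)))
      (fun θ => (circle_ne hw θ).2))
  have d1 : ∫ θ in (0 : ℝ)..2 * Real.pi, AA r (circleMap 0 1 θ) * (1 / (circleMap 0 1 θ - w)) =
      2 * Real.pi * dslope (AA r) 0 w := by
    have : ∮ z in C(0, 1), (z - w)⁻¹ • dslope (AA r) 0 z = Complex.I *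
        ∫ θ in (0 : ℝ)..2 * Real.pi, AA r (circleMap 0 1 θ) * (1 / (circleMap 0 1 θ - w)) := by
      rw [circleIntegral, ← intervalIntegral.integral_const_mul]
      refine intervalIntegral.integral_congr fun θ _ => ?_
      have hne : circleMap 0 1 θ ≠ 0 := circleMap_ne_center one_ne_zero
      have h2 := (circle_ne hw θ).1
      simp only [deriv_circleMap, smul_eq_mul]
      rw [dslope_of_ne _ hne, slope_def_field, AA_zero]
      field_simp
      ring
    rw [this] at c1
    simp only [smul_eq_mul] at c1
    refine mul_left_cancel₀ Complex.I_ne_zero ?_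
    rw [c1]
    ring
  have d2 : ∫ θ in (0 : ℝ)..2 * Real.pi, AA r (circleMap 0 1 θ) *
      (circleMap 0 1 θ / (1 - w * circleMap 0 1 θ)) = 0 := by
    have : ∮ z in C(0, 1), AA r z / (1 - w * z) = Complex.I *
        ∫ θ in (0 : ℝ)..2 * Real.pi, AA r (circleMap 0 1 θ) *
      (circleMap 0 1 θ / (1 - w * circleMap 0 1 θ)) := by
      rw [circleIntegral, ← intervalIntegral.integral_const_mul]
      refine intervalIntegral.integral_congr fun θ _ => ?_
      simp only [deriv_circleMap, smul_eq_mul]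
      ring
    rw [this] at c2
    exact (mul_eq_zero.1 c2).resolve_left Complex.I_ne_zero
  simp only [mul_sub]
  rw [intervalIntegral.integral_sub (hc1.intervalIntegrable _ _) (hc2.intervalIntegrable _ _),
    d1, d2, sub_zero]

lemma circle_two_pi_sub (θ : ℝ) :
    circleMap 0 1 (2 * Real.pi - θ) = starRingEnd ℂ (circleMap 0 1 θ) := by
  apply Complex.ext
  · simp [circleMap, Complex.exp_re]
  · simp [circleMap, Complex.exp_im]

lemma circle_ker {w : ℂ} (hw : ‖w‖ < 1) (θ : ℝ) :
    1 / (circleMap 0 1 θ - w) - circleMap 0 1 θ / (1 - w * circleMap 0 1 θ) =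
      -2 * Complex.I * Real.sin θ / (1 - 2 * w * Real.cos θ + w ^ 2) := by
  obtain ⟨h1, h2⟩ := circle_ne hw θ
  have hne : circleMap 0 1 θ ≠ 0 := circleMap_ne_center one_ne_zero
  have he : circleMap 0 1 θ = Real.cos θ + Real.sin θ * Complex.I := by
    simp [circleMap, Complex.exp_mul_I]
  have hsc : (Real.sin θ : ℂ) ^ 2 + (Real.cos θ : ℂ) ^ 2 = 1 := by
    exact_mod_cast Real.sin_sq_add_cos_sq θ
  have hI := Complex.I_sq
  set e := circleMap 0 1 θ
  have e3 : (e - w) * (1 - w * e) = e * (1 - 2 * w * Real.cos θ + w ^ 2) := by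
    rw [he]
    linear_combination w * hsc + w * (Real.sin θ) ^ 2 * (-1) * hI
  have h3 : 1 - 2 * w * Real.cos θ + w ^ 2 ≠ 0 := by
    intro h
    rw [h, mul_zero] at e3
    exact mul_ne_zero h1 h2 e3
  have e4 : 1 - e ^ 2 = e * (-2 * Complex.I * Real.sin θ) := by
    rw [he]
    linear_combination -hsc + (Real.sin θ) ^ 2 * hI
  rw [div_sub_div _ _ h1 h2, div_eq_div_iff (mul_ne_zero h1 h2) h3, e3]
  linear_combination (1 - 2 * w * Real.cos θ + w ^ 2) * e4

lemma den_ne {w : ℂ} (hw : ‖w‖ < 1) (θ : ℝ) : 1 - 2 * w * Real.cos θ + w ^ 2 ≠ 0 := by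
  obtain ⟨h1, h2⟩ := circle_ne hw θ
  have he : circleMap 0 1 θ = Real.cos θ + Real.sin θ * Complex.I := by
    simp [circleMap, Complex.exp_mul_I]
  have hsc : (Real.sin θ : ℂ) ^ 2 + (Real.cos θ : ℂ) ^ 2 = 1 := by
    exact_mod_cast Real.sin_sq_add_cos_sq θ
  have hI := Complex.I_sq
  set e := circleMap 0 1 θ
  have e3 : (e - w) * (1 - w * e) = e * (1 - 2 * w * Real.cos θ + w ^ 2) := by
    rw [he]
    linear_combination w * hsc + w * (Real.sin θ) ^ 2 * (-1) * hI
  intro h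
  rw [h, mul_zero] at e3
  exact mul_ne_zero h1 h2 e3

lemma FF_int {r : ℝ} (hr : 0 < r) (hr1 : r < 1) {w : ℂ} (hw : ‖w‖ < 1) :
    ∫ θ in Set.Ioo 0 Real.pi, (FF r (Real.cos θ / 2) : ℂ) * Real.sin θ /
      (1 - 2 * w * Real.cos θ + w ^ 2) = Real.pi / 2 * dslope (AA r) 0 w := by
  have h := AA_cauchy hr hr1 hw
  simp only [circle_ker hw] at h
  set K : ℝ → ℂ := fun θ => -2 * Complex.I * Real.sin θ / (1 - 2 * w * Real.cos θ + w ^ 2) with hK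
  have hKc : Continuous K := Continuous.div (by fun_prop) (by fun_prop) (den_ne hw)
  have hcA : Continuous (fun θ : ℝ => AA r (circleMap 0 1 θ)) := by
    refine continuous_iff_continuousAt.2 fun θ => ?_
    have h1 : |r| * ‖circleMap 0 1 θ‖ < 1 := by simp [abs_of_pos hr, hr1]
    exact ContinuousAt.comp (g := AA r) (AA_diff h1).continuousAt
      (continuous_circleMap 0 1).continuousAt
  have hf : Continuous (fun θ : ℝ => AA r (circleMap 0 1 θ) * K θ) := hcA.mul hKc
  have hsplit := intervalIntegral.integral_add_adjacent_intervals
    (hf.intervalIntegrable (μ := volume) 0 Real.pi) (hf.intervalIntegrable Real.pi (2 * Real.pi))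
  have hrefl : ∫ θ in Real.pi..2 * Real.pi, AA r (circleMap 0 1 θ) * K θ =
      ∫ θ in (0 : ℝ)..Real.pi, -(AA r (starRingEnd ℂ (circleMap 0 1 θ)) * K θ) := by
    have := intervalIntegral.integral_comp_sub_left (a := 0) (b := Real.pi)
      (fun θ => AA r (circleMap 0 1 θ) * K θ) (2 * Real.pi)
    rw [sub_zero, show 2 * Real.pi - Real.pi = Real.pi by ring] at this
    rw [← this]
    refine intervalIntegral.integral_congr fun θ _ => ?_
    simp only [circle_two_pi_sub, hK, Real.sin_two_pi_sub, Real.cos_two_pi_sub]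
    push_cast
    ring
  have hcA' : Continuous (fun θ : ℝ => AA r (starRingEnd ℂ (circleMap 0 1 θ))) := by
    have : (fun θ : ℝ => AA r (starRingEnd ℂ (circleMap 0 1 θ))) =
        (fun θ : ℝ => AA r (circleMap 0 1 θ)) ∘ (fun θ => 2 * Real.pi - θ) := by
      funext θ
      simp only [Function.comp, circle_two_pi_sub]
    rw [this]
    exact hcA.comp (by fun_prop)
  have hf' : Continuous (fun θ : ℝ => -(AA r (starRingEnd ℂ (circleMap 0 1 θ)) * K θ)) :=
    (hcA'.mul hKc).neg
  rw [hrefl, ← intervalIntegral.integral_add (hf.intervalIntegrable _ _)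
    (hf'.intervalIntegrable _ _), h] at hsplit
  rw [← integral_Ioc_eq_integral_Ioo, ← intervalIntegral.integral_of_le Real.pi_pos.le]
  have h4 : ∫ θ in (0 : ℝ)..Real.pi, (AA r (circleMap 0 1 θ) * K θ +
      -(AA r (starRingEnd ℂ (circleMap 0 1 θ)) * K θ)) = 4 * ∫ θ in (0 : ℝ)..Real.pi,
      (FF r (Real.cos θ / 2) : ℂ) * Real.sin θ / (1 - 2 * w * Real.cos θ + w ^ 2) := by
    rw [← intervalIntegral.integral_const_mul]
    refine intervalIntegral.integral_congr fun θ hθ => ?_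
    rw [Set.uIcc_of_le Real.pi_pos.le] at hθ
    have := AA_sub hr hr1 hθ.1 hθ.2
    have hI := Complex.I_sq
    simp only [hK]
    have hd := den_ne hw θ
    field_simp
    linear_combination (-2 * Complex.I * Real.sin θ) * this
      - 4 * FF r (Real.cos θ / 2) * Real.sin θ * hI
  rw [h4] at hsplit
  linear_combination hsplit / 4

lemma FF_den {r : ℝ} (hr : 0 < r) (hr1 : r < 1) (x : ℝ) :
    0 < 1 + r ^ 2 - 2 * r * √(1 - 4 * x ^ 2) := by
  have h1 : √(1 - 4 * x ^ 2) ≤ 1 := by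
    rw [Real.sqrt_le_left (by norm_num)]
    nlinarith [sq_nonneg x]
  have h2 : 0 < (1 - r) ^ 2 := by
    have : 0 < 1 - r := by linarith
    positivity
  nlinarith

lemma FF_out {r : ℝ} {x : ℝ} (hx : x ∉ Set.Ioo (-(1 / 2) : ℝ) (1 / 2)) : FF r x = 0 := by
  have : 1 - 4 * x ^ 2 ≤ 0 := by
    rw [Set.mem_Ioo, not_and_or, not_lt, not_lt] at hx
    rcases hx with h | h <;> nlinarith
  unfold FF
  rw [Real.sqrt_eq_zero_of_nonpos this]
  have : (1 + r ^ 2 : ℝ) ≠ 0 := by positivity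
  simp [this]

lemma FF_continuous {r : ℝ} (hr : 0 < r) (hr1 : r < 1) : Continuous (FF r) := by
  unfold FF
  refine continuous_const.mul (Continuous.log (Continuous.div (by fun_prop) (by fun_prop)
    (fun x => (FF_den hr hr1 x).ne')) (fun x => ?_))
  exact (div_pos (by positivity) (FF_den hr hr1 x)).ne'

lemma FF_nonneg {r : ℝ} (hr : 0 < r) (hr1 : r < 1) (x : ℝ) : 0 ≤ FF r x := by
  unfold FF
  refine mul_nonneg (by norm_num) (Real.log_nonneg ?_)
  rw [le_div_iff₀ (FF_den hr hr1 x)]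
  have : 0 ≤ r * √(1 - 4 * x ^ 2) := by positivity
  linarith

lemma FF_mem {r : ℝ} (hr : 0 < r) (hr1 : r < 1) : memAstar (FF r) := by
  refine ⟨?_, Eventually.of_forall (FF_nonneg hr hr1), Eventually.of_forall fun x hx => ?_⟩
  · refine (FF_continuous hr hr1).integrable_of_hasCompactSupport
      (HasCompactSupport.intro (isCompact_Icc (a := (-(1 / 2) : ℝ)) (b := 1 / 2)) fun x hx => ?_)
    exact FF_out (fun h => hx ⟨h.1.le, h.2.le⟩)
  · exact FF_out (fun h => hx ⟨h.1.le, h.2.le⟩)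

lemma FF_integral {r : ℝ} (hr : 0 < r) (hr1 : r < 1) : ∫ x, |FF r x| = Real.pi * r / 2 := by
  rw [integral_abs_supp (FF_mem hr hr1), cos_change]
  have h := FF_int hr hr1 (w := 0) (by simp)
  rw [dslope_same, AA_deriv] at h
  have e : ∀ θ : ℝ, (FF r (Real.cos θ / 2) : ℂ) * Real.sin θ / (1 - 2 * 0 * Real.cos θ + 0 ^ 2) =
      ((2 * ((Real.sin θ / 2) • FF r (Real.cos θ / 2)) : ℝ) : ℂ) := by
    intro θ
    push_cast
    simp
    ring
  simp only [e] at h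
  rw [integral_complex_ofReal, integral_const_mul] at h
  have h' : 2 * ∫ θ in Set.Ioo 0 Real.pi, (Real.sin θ / 2) • FF r (Real.cos θ / 2) =
      Real.pi / 2 * (2 * r) := by exact_mod_cast h
  linarith

lemma FF_cauchy {r : ℝ} (hr : 0 < r) (hr1 : r < 1) {w z : ℂ} (hw : ‖w‖ < 1) (hw0 : w ≠ 0)
    (hz : w ^ 2 + 1 = 4 * z * w) : cauchyT (FF r) z = AA r w := by
  have hpi : (Real.pi : ℂ) ≠ 0 := by exact_mod_cast Real.pi_pos.ne'
  have h1 : ∫ t : ℝ, (FF r t : ℂ) / (z - t) =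
      ∫ t in Set.Ioo (-(1 / 2) : ℝ) (1 / 2), (FF r t : ℂ) / (z - t) := by
    refine (setIntegral_eq_integral_of_forall_compl_eq_zero fun x hx => ?_).symm
    rw [FF_out hx]
    simp
  have h2 : ∀ θ : ℝ, (Real.sin θ / 2) • ((FF r (Real.cos θ / 2) : ℂ) /
      (z - (Real.cos θ / 2 : ℝ))) = 2 * w * ((FF r (Real.cos θ / 2) : ℂ) * Real.sin θ /
      (1 - 2 * w * Real.cos θ + w ^ 2)) := by
    intro θ
    have hd := den_ne hw θ
    have e : (1 - 2 * w * Real.cos θ + w ^ 2) = 4 * w * (z - (Real.cos θ / 2 : ℝ)) := by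
      push_cast
      linear_combination hz
    have hne : z - (Real.cos θ / 2 : ℝ) ≠ 0 := by
      intro h
      rw [e, h, mul_zero] at hd
      exact hd rfl
    rw [e, Complex.real_smul]
    push_cast at hne ⊢
    field_simp
    ring
  unfold cauchyT
  rw [h1, cos_change]
  simp only [h2]
  rw [integral_const_mul, FF_int hr hr1 hw, dslope_of_ne _ hw0, slope_def_field, AA_zero]
  push_cast
  field_simp
  ring

lemma root_exists (z : ℂ) : ∃ w : ℂ, w ≠ 0 ∧ ‖w‖ ≤ 1 ∧ w ^ 2 + 1 = 4 * z * w := by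
  obtain ⟨s, hs⟩ := IsAlgClosed.exists_pow_nat_eq (4 * z ^ 2 - 1) (n := 2) (by norm_num)
  have hu : (2 * z + s) ^ 2 + 1 = 4 * z * (2 * z + s) := by linear_combination hs
  have hu0 : 2 * z + s ≠ 0 := by
    intro h
    rw [h] at hu
    simp at hu
  set u := 2 * z + s
  by_cases h : ‖u‖ ≤ 1
  · exact ⟨u, hu0, h, hu⟩
  · refine ⟨u⁻¹, inv_ne_zero hu0, ?_, ?_⟩
    · rw [norm_inv]
      exact inv_le_one_of_one_le₀ (not_le.1 h).le
    · field_simp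
      linear_combination hu

lemma root_im {w z : ℂ} (hw0 : w ≠ 0) (hw : ‖w‖ ≤ 1) (hz : w ^ 2 + 1 = 4 * z * w)
    (him : 0 < z.im) : ‖w‖ < 1 ∧ w.im < 0 := by
  have hn : 0 < Complex.normSq w := Complex.normSq_pos.2 hw0
  have hn1 : Complex.normSq w ≤ 1 := by
    rw [Complex.normSq_eq_norm_sq]
    nlinarith [norm_nonneg w]
  have e : w + w⁻¹ = 4 * z := by
    field_simp
    linear_combination hz
  have e2 := congrArg Complex.im e
  have h4 : (4 * z).im = 4 * z.im := by simp
  rw [Complex.add_im, Complex.inv_im, h4] at e2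
  have e3 : w.im * (Complex.normSq w - 1) = 4 * z.im * Complex.normSq w := by
    field_simp at e2
    linarith
  have h5 : 0 < 4 * z.im * Complex.normSq w := by positivity
  rw [← e3] at h5
  have h6 : Complex.normSq w < 1 := by
    rcases hn1.lt_or_eq with h | h
    · exact h
    · rw [h] at h5
      simp at h5
  constructor
  · rw [Complex.normSq_eq_norm_sq] at h6
    nlinarith [norm_nonneg w]
  · nlinarith

lemma root_lower (x : ℝ) : ∃ w : ℂ, w ≠ 0 ∧ ‖w‖ ≤ 1 ∧ w ^ 2 + 1 = 4 * x * w ∧ w.im ≤ 0 := by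
  obtain ⟨w, h0, h1, h2⟩ := root_exists x
  by_cases h : w.im ≤ 0
  · exact ⟨w, h0, h1, h2, h⟩
  · refine ⟨starRingEnd ℂ w, by simpa using h0, by simpa using h1, ?_, ?_⟩
    · have := congrArg (starRingEnd ℂ) h2
      simpa [map_ofNat] using this
    · simp only [Complex.conj_im]
      linarith

lemma FF_limit {r : ℝ} (hr : 0 < r) (hr1 : r < 1) (x : ℝ) (hx : 4 * x ^ 2 ≠ 1) :
    ∃ L : ℝ, |L| ≤ Real.pi / 2 ∧ Tendsto (fun δ : ℝ =>
      (cauchyT (FF r) ((x : ℂ) + δ * Complex.I)).re) (𝓝[>] 0) (𝓝 L) := by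
  obtain ⟨v, v0, v1, v2, v3⟩ := root_lower x
  have hrv : |r| * ‖v‖ < 1 := by
    rw [abs_of_pos hr]
    nlinarith [norm_nonneg v]
  refine ⟨(AA r v).re, AA_re_le hrv, ?_⟩
  choose W W0 W1 W2 using fun δ : ℝ => root_exists ((x : ℂ) + δ * Complex.I)
  have hvn : 0 < ‖v‖ := norm_pos_iff.2 v0
  have hc : ∃ c : ℝ, 0 < c ∧ ∀ w : ℂ, ‖w‖ ≤ 1 → w.im < 0 → c ≤ ‖w - v⁻¹‖ := by
    rcases v1.lt_or_eq with h | h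
    · refine ⟨‖v‖⁻¹ - 1, ?_, fun w hw _ => ?_⟩
      · have := (one_lt_inv₀ hvn).2 h
        linarith
      · have := norm_sub_norm_le v⁻¹ w
        rw [norm_inv, norm_sub_rev] at this
        linarith
    · have hns : Complex.normSq v = 1 := by
        rw [Complex.normSq_eq_norm_sq, h, one_pow]
      have hvi : v.im ≠ 0 := by
        intro hi
        rw [Complex.normSq_apply, hi] at hns
        have e := congrArg Complex.re v2
        have e' : v.re ^ 2 + 1 = 4 * x * v.re := by
          simpa [pow_two, hi] using e
        apply hx
        have h2 : v.re ^ 2 = 1 := by linarith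
        have h3 : 2 = 4 * x * v.re := by linarith
        have h4 : (4 * x * v.re) ^ 2 = 4 := by rw [← h3]; norm_num
        have h5 : (4 * x * v.re) ^ 2 = 16 * x ^ 2 * v.re ^ 2 := by ring
        rw [h2] at h5
        linarith
      refine ⟨-v.im, by have := lt_of_le_of_ne v3 hvi; linarith, fun w _ hw => ?_⟩
      have := Complex.abs_im_le_norm (w - v⁻¹)
      rw [Complex.sub_im, Complex.inv_im, hns, div_one] at this
      have h2 := (abs_le.1 this).1
      linarith
  obtain ⟨c, c0, hc⟩ := hc
  have hbound : ∀ δ : ℝ, 0 < δ → ‖W δ - v‖ ≤ 4 * δ / c := by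
    intro δ hδ
    obtain ⟨n1, n2⟩ := root_im (W0 δ) (W1 δ) (W2 δ) (by simpa using hδ)
    have e : (W δ - v) * (W δ - v⁻¹) = 4 * δ * Complex.I * W δ := by
      have w2 := W2 δ
      field_simp
      linear_combination v * w2 - W δ * v2
    have en := congrArg norm e
    rw [norm_mul, norm_mul, norm_mul, norm_mul, Complex.norm_I, Complex.norm_real,
      Real.norm_eq_abs, abs_of_pos hδ] at en
    have h4 : ‖(4 : ℂ)‖ = 4 := by simp
    rw [h4] at en
    have hcw := hc _ (W1 δ) n2
    rw [le_div_iff₀ c0]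
    calc ‖W δ - v‖ * c ≤ ‖W δ - v‖ * ‖W δ - v⁻¹‖ := by gcongr
      _ = 4 * δ * 1 * ‖W δ‖ := en
      _ ≤ 4 * δ * 1 * 1 := by
        have := W1 δ
        gcongr
      _ = 4 * δ := by ring
  have hW : Tendsto W (𝓝[>] 0) (𝓝 v) := by
    rw [tendsto_iff_norm_sub_tendsto_zero]
    refine squeeze_zero' (Eventually.of_forall fun _ => norm_nonneg _)
      (g := fun δ => 4 * δ / c) ?_ ?_
    · filter_upwards [self_mem_nhdsWithin] with δ hδ
      exact hbound δ hδ
    · have : Tendsto (fun δ : ℝ => 4 * δ / c) (𝓝 0) (𝓝 (4 * 0 / c)) :=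
        Continuous.tendsto (by fun_prop) 0
      simp only [mul_zero, zero_div] at this
      exact this.mono_left nhdsWithin_le_nhds
  have hA := (Complex.continuous_re.tendsto _).comp ((AA_diff hrv).continuousAt.tendsto.comp hW)
  refine hA.congr' ?_
  filter_upwards [self_mem_nhdsWithin] with δ hδ
  obtain ⟨n1, n2⟩ := root_im (W0 δ) (W1 δ) (W2 δ) (by simpa using hδ)
  simp only [Function.comp]
  rw [FF_cauchy hr hr1 n1 (W0 δ) (W2 δ)]

lemma FF_pv {r : ℝ} (hr : 0 < r) (hr1 : r < 1) : ∃ G : ℝ → ℝ, (∀ x, |G x| ≤ Real.pi / 2) ∧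
    ∀ᵐ x ∂(volume : Measure ℝ), pvHilbAt (FF r) x (G x) := by
  have hpi := Real.pi_pos
  have : ∀ x : ℝ, ∃ L : ℝ, |L| ≤ Real.pi / 2 ∧ (4 * x ^ 2 ≠ 1 → Tendsto (fun δ : ℝ =>
      (cauchyT (FF r) ((x : ℂ) + δ * Complex.I)).re) (𝓝[>] 0) (𝓝 L)) := by
    intro x
    by_cases hx : 4 * x ^ 2 = 1
    · exact ⟨0, by simpa using (half_pos hpi).le, fun h => absurd hx h⟩
    · obtain ⟨L, h1, h2⟩ := FF_limit hr hr1 x hx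
      exact ⟨L, h1, fun _ => h2⟩
  choose G G1 G2 using this
  refine ⟨G, G1, ?_⟩
  have hne : ∀ᵐ x : ℝ, x ∉ ({1 / 2, -(1 / 2)} : Set ℝ) :=
    (Set.toFinite _).countable.ae_notMem _
  filter_upwards [ct_ae _ (FF_mem hr hr1).1, hne] with x h1 h2
  have hx : 4 * x ^ 2 ≠ 1 := by
    intro h
    apply h2
    have : (x - 1 / 2) * (x + 1 / 2) = 0 := by linarith
    rcases mul_eq_zero.1 this with h | h
    · left; linarith
    · right
      show x = _
      linarith
  have h3 := (G2 x hx).sub h1.2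
  rw [sub_zero] at h3
  refine h3.congr fun δ => ?_
  ring

/-- For every nonzero `F ∈ 𝒜*` one has `‖𝓗(F)‖_{L∞(ℝ)} ≥ ‖F‖_{L¹(ℝ)}` (essential supremum);
consequently the infimum in the extremal problem (EP2) equals `1`. -/
theorem stmt4 :
    (∀ F : ℝ → ℝ, memAstar F → ¬(F =ᵐ[volume] (0 : ℝ → ℝ)) →
      ∀ G : ℝ → ℝ, (∀ᵐ x ∂(volume : Measure ℝ), pvHilbAt F x (G x)) →
        ENNReal.ofReal (∫ x : ℝ, |F x|) ≤ eLpNorm G ⊤ volume) ∧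
    sInf {r : ENNReal | ∃ F G : ℝ → ℝ, memAstar F ∧ ¬(F =ᵐ[volume] (0 : ℝ → ℝ)) ∧
      (∀ᵐ x ∂(volume : Measure ℝ), pvHilbAt F x (G x)) ∧
      r = eLpNorm G ⊤ volume / ENNReal.ofReal (∫ x : ℝ, |F x|)} = 1 := by
  have part1 : ∀ F : ℝ → ℝ, memAstar F →
      ∀ G : ℝ → ℝ, (∀ᵐ x ∂(volume : Measure ℝ), pvHilbAt F x (G x)) →
        ENNReal.ofReal (∫ x : ℝ, |F x|) ≤ eLpNorm G ⊤ volume := by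
    intro F hF G hG
    by_cases htop : eLpNorm G ⊤ volume = ⊤
    · rw [htop]
      exact le_top
    · refine ENNReal.ofReal_le_of_le_toReal (main_ineq F G hF hG _ ?_)
      rw [eLpNorm_exponent_top] at htop ⊢
      filter_upwards [ae_le_eLpNormEssSup (f := G) (μ := (volume : Measure ℝ))] with x hx
      have := ENNReal.toReal_mono htop hx
      simpa using this
  refine ⟨fun F hF _ G hG => part1 F hF G hG, le_antisymm ?_ ?_⟩
  · have hle : ∀ r : ℝ, 0 < r → r < 1 → sInf {r : ENNReal | ∃ F G : ℝ → ℝ, memAstar F ∧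
        ¬(F =ᵐ[volume] (0 : ℝ → ℝ)) ∧ (∀ᵐ x ∂(volume : Measure ℝ), pvHilbAt F x (G x)) ∧
        r = eLpNorm G ⊤ volume / ENNReal.ofReal (∫ x : ℝ, |F x|)} ≤ ENNReal.ofReal (r⁻¹) := by
      intro r hr hr1
      have hpi := Real.pi_pos
      obtain ⟨G, hG1, hG2⟩ := FF_pv hr hr1
      refine le_trans (sInf_le ⟨FF r, G, FF_mem hr hr1, ?_, hG2, rfl⟩) ?_
      · intro h
        have h1 : ∫ x, |FF r x| = 0 := by
          rw [integral_congr_ae (g := fun _ => (0 : ℝ))]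
          · simp
          · filter_upwards [h] with x hx
            rw [hx]
            simp
        rw [FF_integral hr hr1] at h1
        have : 0 < Real.pi * r / 2 := by positivity
        linarith
      · rw [FF_integral hr hr1]
        have h1 : eLpNorm G ⊤ volume ≤ ENNReal.ofReal (Real.pi / 2) := by
          rw [eLpNorm_exponent_top]
          exact eLpNormEssSup_le_of_ae_bound (Eventually.of_forall fun x => by
            rw [Real.norm_eq_abs]
            exact hG1 x)
        refine (ENNReal.div_le_div_right h1 _).trans (le_of_eq ?_)
        rw [← ENNReal.ofReal_div_of_pos (by positivity)]
        congr 1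
        field_simp
    have hlim : Tendsto (fun r : ℝ => ENNReal.ofReal (r⁻¹)) (𝓝[<] 1) (𝓝 1) := by
      have h1 : Tendsto (fun r : ℝ => r⁻¹) (𝓝[<] 1) (𝓝 1) := by
        have := (tendsto_inv₀ (one_ne_zero (α := ℝ))).mono_left
          (nhdsWithin_le_nhds (s := Set.Iio (1 : ℝ)))
        simpa using this
      simpa using ENNReal.tendsto_ofReal h1
    refine ge_of_tendsto hlim ?_
    filter_upwards [Ioo_mem_nhdsLT (zero_lt_one (α := ℝ))] with r hr
    exact hle r hr.1 hr.2
  · refine le_sInf ?_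
    rintro _ ⟨F, G, hF, hF0, hG, rfl⟩
    have hpos : 0 < ∫ x, |F x| := by
      refine lt_of_le_of_ne (integral_nonneg fun x => abs_nonneg _) fun h => hF0 ?_
      have := (integral_eq_zero_iff_of_nonneg (fun x => abs_nonneg (F x)) hF.1.abs).1 h.symm
      filter_upwards [this] with x hx
      simpa using hx
    rw [ENNReal.le_div_iff_mul_le (Or.inl (by simpa using hpos)) (Or.inl ENNReal.ofReal_ne_top),
      one_mul]
    exact part1 F hF G hG
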